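/- arXiv:2310.15600 — 8 statements merged into one kernel-verified Lean document; each statement's English description precedes it below -/
import Mathlib

section
/- Let K be an algebraically closed field of characteristic 0, let n ≥ 1 be a natural number, and let λ₁, λ₂, λ₃, μ₁, μ₂, μ₃ ∈ K. Define f(x,y,z) = λ₁xyz + λ₂yzx + λ₃zxy + μ₁zyx + μ₂xzy + μ₃yxz. Then the image of f in Mₙ(K), i.e. the set { f(a,b,c) : a, b, c ∈ Mₙ(K) }, is a K-vector subspace of Mₙ(K) (there exists a K-submodule V of Mₙ(K) whose underlying set equals this image). -/
open Matrix in
/-- Relabelling the indices of a square matrix by a permutation is a similarity. -/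
theorem isConj_submatrix_perm {K ι : Type*} [Field K] [Fintype ι] [DecidableEq ι]
    (A : Matrix ι ι K) (σ : Equiv.Perm ι) : IsConj A (A.submatrix σ σ) := by
  refine ⟨⟨σ.toPEquiv.toMatrix, σ.symm.toPEquiv.toMatrix, ?_, ?_⟩, ?_⟩
  · rw [PEquiv.toMatrix_toPEquiv_mul]
    ext i j
    simp [PEquiv.toMatrix_apply, Matrix.one_apply]
  · rw [PEquiv.toMatrix_toPEquiv_mul]
    ext i j
    simp [PEquiv.toMatrix_apply, Matrix.one_apply]
  · change _ * _ = _ * _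
    simp only
    rw [PEquiv.toMatrix_toPEquiv_mul, PEquiv.mul_toMatrix_toPEquiv]
    ext i j
    simp

theorem single_mul_apply_eq_ite {K ι : Type*} [Field K] [Fintype ι] [DecidableEq ι]
    (M : Matrix ι ι K) (a b i j : ι) (s : K) :
    (Matrix.single a b s * M) i j = if i = a then s * M b j else 0 := by
  split_ifs with h
  · subst h; simp
  · simp [h]

theorem mul_single_apply_eq_ite {K ι : Type*} [Field K] [Fintype ι] [DecidableEq ι]
    (M : Matrix ι ι K) (a b i j : ι) (s : K) :
    (M * Matrix.single a b s) i j = if j = b then M i a * s else 0 := by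
  split_ifs with h
  · subst h; simp
  · simp [h]

/-- Conjugation by an elementary transvection. -/
theorem isConj_transvection {K ι : Type*} [Field K] [Fintype ι] [DecidableEq ι]
    (A : Matrix ι ι K) {i j : ι} (hij : i ≠ j) :
    IsConj A ((1 + Matrix.single i j 1) * A * (1 - Matrix.single i j 1)) := by
  have h : Matrix.single i j (1 : K) * Matrix.single i j 1 = 0 := by
    simp [Matrix.single_mul_single_of_ne, hij.symm]
  have h1 : (1 - Matrix.single i j (1 : K)) * (1 + Matrix.single i j 1) = 1 := by
    noncomm_ring [h]
  refine ⟨⟨1 + Matrix.single i j 1, 1 - Matrix.single i j 1, ?_, h1⟩, ?_⟩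
  · noncomm_ring [h]
  · change _ * _ = _ * _
    simp only
    rw [mul_assoc, h1, mul_one]

/-- A nonscalar matrix is similar to one whose entry at a prescribed off-diagonal place is
nonzero. -/
theorem exists_isConj_apply_ne_zero {K ι : Type*} [Field K] [Fintype ι] [DecidableEq ι]
    {A : Matrix ι ι K} (hA : A ∉ Set.range (Matrix.scalar ι)) {a b : ι} (hab : a ≠ b) :
    ∃ B, IsConj A B ∧ B b a ≠ 0 := by
  by_contra! H
  have offdiag : ∀ B, IsConj A B → ∀ i j, i ≠ j → B i j = 0 := by
    intro B hB i j hij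
    obtain ⟨σ, h1, h2⟩ := MulAction.is_two_pretransitive_iff.mp
      (Equiv.Perm.isMultiplyPretransitive ι 2) hab.symm hij
    have := H _ (hB.trans (isConj_submatrix_perm B σ))
    simp only [Equiv.Perm.smul_def] at h1 h2
    simpa [h1, h2] using this
  have diag_eq : ∀ i j, A i i = A j j := by
    intro i j
    by_cases hij : i = j
    · rw [hij]
    have h := offdiag _ (isConj_transvection A hij) i j hij
    simp [mul_sub, add_mul,
      offdiag A (IsConj.refl A) i j hij, offdiag A (IsConj.refl A) j i (Ne.symm hij)] at h
    linear_combination -h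
  refine hA ⟨A a a, ?_⟩
  ext i j
  by_cases hij : i = j
  · subst hij; simp [diag_eq i a]
  · simp [hij, offdiag A (IsConj.refl A) i j hij]

open Matrix in
theorem isConj_fromBlocks_shear {K ι κ : Type*} [Field K] [Fintype ι] [DecidableEq ι]
    [Fintype κ] [DecidableEq κ] (A : Matrix κ κ K) (S : Matrix κ ι K) (W : Matrix ι κ K)
    (B : Matrix ι ι K) (R : Matrix κ ι K) :
    IsConj (fromBlocks A S W B)
      (fromBlocks (A + R * W) (S + R * B - (A + R * W) * R) W (B - W * R)) := by
  refine ⟨⟨fromBlocks 1 R 0 1, fromBlocks 1 (-R) 0 1, ?_, ?_⟩, ?_⟩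
  · simp [fromBlocks_multiply]
  · simp [fromBlocks_multiply]
  · change _ * _ = _ * _
    simp [fromBlocks_multiply]

open Matrix in
theorem IsConj.fromBlocks_right {K ι κ : Type*} [Field K] [Fintype ι] [DecidableEq ι]
    [Fintype κ] [DecidableEq κ] (A : Matrix κ κ K) (S : Matrix κ ι K) (W : Matrix ι κ K)
    {B B' : Matrix ι ι K} (h : IsConj B B') :
    ∃ S' W', IsConj (fromBlocks A S W B) (fromBlocks A S' W' B') := by
  obtain ⟨P, hP⟩ := h
  refine ⟨S * ((P⁻¹ : (Matrix ι ι K)ˣ) : Matrix ι ι K), (P : Matrix ι ι K) * W,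
    ⟨fromBlocks 1 0 0 P, fromBlocks 1 0 0 (P⁻¹ : (Matrix ι ι K)ˣ), ?_, ?_⟩, ?_⟩
  · simp [fromBlocks_multiply]
  · simp [fromBlocks_multiply]
  · change _ * _ = _ * _
    have hP' : (P : Matrix ι ι K) * B = B' * P := hP
    simp [fromBlocks_multiply, hP', Matrix.mul_assoc]

theorem isConj_reindex {K ι κ : Type*} [Field K] [Fintype ι] [DecidableEq ι]
    [Fintype κ] [DecidableEq κ] (e : ι ≃ κ) {A B : Matrix ι ι K} (h : IsConj A B) :
    IsConj (Matrix.reindexAlgEquiv K K e A) (Matrix.reindexAlgEquiv K K e B) :=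
  (Matrix.reindexAlgEquiv K K e).toMonoidHom.map_isConj h

theorem trace_eq_of_isConj {K ι : Type*} [Field K] [Fintype ι] [DecidableEq ι]
    {A B : Matrix ι ι K} (h : IsConj A B) : A.trace = B.trace := by
  obtain ⟨P, hP⟩ := h
  have hP' : (P : Matrix ι ι K) * A = B * P := hP
  calc A.trace = ((P⁻¹ : (Matrix ι ι K)ˣ) * (P * A) : Matrix ι ι K).trace := by
        rw [← mul_assoc]; simp
    _ = B.trace := by rw [hP', Matrix.trace_mul_comm, mul_assoc]; simp

theorem mem_range_scalar_of_isConj {K ι : Type*} [Field K] [Fintype ι] [DecidableEq ι]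
    {A B : Matrix ι ι K} (h : IsConj A B) (hB : B ∈ Set.range (Matrix.scalar ι)) :
    A ∈ Set.range (Matrix.scalar ι) := by
  obtain ⟨c, rfl⟩ := hB
  obtain ⟨P, hP⟩ := h
  have hP' : (P : Matrix ι ι K) * A = Matrix.scalar ι c * P := hP
  refine ⟨c, ?_⟩
  rw [(Matrix.scalar_commute c (fun r => Commute.all _ _) (P : Matrix ι ι K)).eq] at hP'
  exact (P.isUnit.mul_left_cancel hP').symm

/-- Every nonscalar matrix is similar to one whose diagonal vanishes except for prescribed values
at `a` and `b`, and whose entry at `(b, a)` is nonzero. -/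
def HasTwoEntryDiagonalForm (K : Type*) {ι : Type*} [Field K] [Fintype ι] [DecidableEq ι]
    (a b : ι) : Prop :=
  ∀ A : Matrix ι ι K, A ∉ Set.range (Matrix.scalar ι) → ∀ p q : K, p + q = A.trace →
    ∃ B, IsConj A B ∧ (∀ i, B i i = if i = a then p else if i = b then q else 0) ∧ B b a ≠ 0

open Matrix in
theorem hasTwoEntryDiagonalForm_unit_sum_unit (K : Type*) [Field K] :
    HasTwoEntryDiagonalForm K (Sum.inl () : Unit ⊕ Unit) (Sum.inr ()) := by
  intro A hA p q hpq
  obtain ⟨B, hAB, hB⟩ := exists_isConj_apply_ne_zero hA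
    (Sum.inl_ne_inr : (Sum.inl () : Unit ⊕ Unit) ≠ Sum.inr ())
  rw [trace_eq_of_isConj hAB] at hpq
  have h := isConj_fromBlocks_shear B.toBlocks₁₁ B.toBlocks₁₂ B.toBlocks₂₁ B.toBlocks₂₂
    (of fun _ _ => (p - B (Sum.inl ()) (Sum.inl ())) / B (Sum.inr ()) (Sum.inl ()))
  rw [fromBlocks_toBlocks] at h
  refine ⟨_, hAB.trans h, ?_, ?_⟩
  · simp [Matrix.trace] at hpq
    rintro (i | i)
    · simp [Matrix.mul_apply, toBlocks₁₁, toBlocks₂₁, hB]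
    · simp [Matrix.mul_apply, toBlocks₂₂, toBlocks₂₁]
      field_simp
      linear_combination -hpq
  · simpa [toBlocks₂₁] using hB

open Matrix in
theorem HasTwoEntryDiagonalForm.unit_sum {K ι : Type*} [Field K] [Fintype ι] [DecidableEq ι]
    {a b : ι} (hab : a ≠ b) (H : HasTwoEntryDiagonalForm K a b) :
    HasTwoEntryDiagonalForm K (Sum.inr a : Unit ⊕ ι) (Sum.inr b) := by
  intro A hA p q hpq
  obtain ⟨B, hAB, hB⟩ := exists_isConj_apply_ne_zero hA
    (Sum.inl_ne_inr : (Sum.inl () : Unit ⊕ ι) ≠ Sum.inr a)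
  set w : ι → K := fun i => B (Sum.inr i) (Sum.inl ()) with hw
  have hwa : w a ≠ 0 := hB
  obtain ⟨r, hr, hrs⟩ : ∃ r : ι → K, r ⬝ᵥ w = -B (Sum.inl ()) (Sum.inl ()) ∧
      B.toBlocks₂₂ - vecMulVec w r ∉ Set.range (Matrix.scalar ι) := by
    set r₀ : ι → K := Pi.single a (-B (Sum.inl ()) (Sum.inl ()) / w a)
    have hr₀ : r₀ ⬝ᵥ w = -B (Sum.inl ()) (Sum.inl ()) := by
      simp [r₀, hwa]
    by_cases h : B.toBlocks₂₂ - vecMulVec w r₀ ∈ Set.range (Matrix.scalar ι)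
    · refine ⟨r₀ + (Pi.single b (w a) - Pi.single a (w b)), ?_, ?_⟩
      · rw [add_dotProduct, hr₀, sub_dotProduct]
        simp [mul_comm]
      · rintro ⟨c, hc⟩
        obtain ⟨c', hc'⟩ := h
        have e1 := congrFun (congrFun hc a) b
        have e2 := congrFun (congrFun hc' a) b
        simp [hab, hab.symm, vecMulVec_apply] at e1 e2
        have : w a * w a = 0 := by linear_combination e1 - e2
        exact hwa (mul_self_eq_zero.mp this)
    · exact ⟨r₀, hr₀, h⟩
  have h := isConj_fromBlocks_shear B.toBlocks₁₁ B.toBlocks₁₂ B.toBlocks₂₁ B.toBlocks₂₂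
    (of fun _ i => r i)
  rw [fromBlocks_toBlocks] at h
  have hWR : B.toBlocks₂₁ * (of fun _ i => r i : Matrix Unit ι K) = vecMulVec w r := by
    ext i j
    simp [Matrix.mul_apply, toBlocks₂₁, vecMulVec_apply, hw]
  have hRW : B.toBlocks₁₁ + (of fun _ i => r i : Matrix Unit ι K) * B.toBlocks₂₁ = 0 := by
    ext i j
    have : ∑ x, r x * B (Sum.inr x) (Sum.inl ()) = -B (Sum.inl ()) (Sum.inl ()) := hr
    simp [Matrix.mul_apply, toBlocks₂₁, toBlocks₁₁, this]
  rw [hWR, hRW] at h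
  have htr : p + q = (B.toBlocks₂₂ - vecMulVec w r).trace := by
    rw [hpq, trace_eq_of_isConj (hAB.trans h)]
    simp [Matrix.trace, Fintype.sum_sum_type]
  obtain ⟨C, hC, hdiag, hba⟩ := H _ hrs p q htr
  obtain ⟨S', W', hS⟩ := hC.fromBlocks_right 0
    (B.toBlocks₁₂ + (of fun _ i => r i : Matrix Unit ι K) * B.toBlocks₂₂ -
      (0 : Matrix Unit Unit K) * (of fun _ i => r i : Matrix Unit ι K)) B.toBlocks₂₁
  refine ⟨_, (hAB.trans h).trans hS, ?_, ?_⟩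
  · rintro (i | i)
    · simp
    · simp [hdiag]
  · simpa using hba

theorem HasTwoEntryDiagonalForm.congr {K ι κ : Type*} [Field K] [Fintype ι] [DecidableEq ι]
    [Fintype κ] [DecidableEq κ] {a b : ι} (H : HasTwoEntryDiagonalForm K a b) (e : ι ≃ κ) :
    HasTwoEntryDiagonalForm K (e a) (e b) := by
  intro A hA p q hpq
  obtain ⟨B, hB, hdiag, hba⟩ := H (Matrix.reindexAlgEquiv K K e.symm A) (by
    rintro ⟨c, hc⟩
    refine hA ⟨c, ?_⟩
    ext i j
    simpa [Matrix.diagonal_apply] using congrFun (congrFun hc (e.symm i)) (e.symm j)) p q (by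
    rw [hpq]
    exact (Fintype.sum_equiv e _ _ (by simp)).symm)
  refine ⟨Matrix.reindexAlgEquiv K K e B, ?_, ?_, ?_⟩
  · have := isConj_reindex e hB
    rwa [← Matrix.symm_reindexAlgEquiv, AlgEquiv.apply_symm_apply] at this
  · intro i
    simp [hdiag, Equiv.symm_apply_eq]
  · simpa using hba

theorem exists_hasTwoEntryDiagonalForm_fin (K : Type*) [Field K] (n : ℕ) :
    ∃ a b : Fin (n + 2), a ≠ b ∧ HasTwoEntryDiagonalForm K a b := by
  induction n with
  | zero =>
    let e : Unit ⊕ Unit ≃ Fin 2 := Fintype.equivOfCardEq (by simp)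
    exact ⟨_, _, e.injective.ne Sum.inl_ne_inr,
      (hasTwoEntryDiagonalForm_unit_sum_unit K).congr e⟩
  | succ n ih =>
    obtain ⟨a, b, hab, H⟩ := ih
    let e : Unit ⊕ Fin (n + 2) ≃ Fin (n + 1 + 2) := Fintype.equivOfCardEq (by simp; omega)
    exact ⟨_, _, e.injective.ne (Sum.inr_injective.ne hab), (H.unit_sum hab).congr e⟩

/-- The multilinear polynomial of degree three with the given coefficients, evaluated at
matrices. -/
def cubicEval {K ι : Type*} [Field K] [Fintype ι] (l1 l2 l3 m1 m2 m3 : K)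
    (a b c : Matrix ι ι K) : Matrix ι ι K :=
  l1 • (a * b * c) + l2 • (b * c * a) + l3 • (c * a * b)
    + m1 • (c * b * a) + m2 • (a * c * b) + m3 • (b * a * c)

/-- The matrix `w` is a value of the multilinear polynomial with the given coefficients. -/
def IsCubicValue {K ι : Type*} [Field K] [Fintype ι] (l1 l2 l3 m1 m2 m3 : K)
    (w : Matrix ι ι K) : Prop :=
  ∃ a b c : Matrix ι ι K, w = cubicEval l1 l2 l3 m1 m2 m3 a b c

section

variable {K ι : Type*} [Field K] [Fintype ι] {l1 l2 l3 m1 m2 m3 : K}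

theorem IsCubicValue.rotate {w : Matrix ι ι K} (h : IsCubicValue l2 l3 l1 m2 m3 m1 w) :
    IsCubicValue l1 l2 l3 m1 m2 m3 w := by
  obtain ⟨a, b, c, rfl⟩ := h
  refine ⟨c, a, b, ?_⟩
  simp only [cubicEval]
  abel

theorem IsCubicValue.smul {w : Matrix ι ι K} (h : IsCubicValue l1 l2 l3 m1 m2 m3 w) (t : K) :
    IsCubicValue l1 l2 l3 m1 m2 m3 (t • w) := by
  obtain ⟨a, b, c, rfl⟩ := h
  refine ⟨t • a, b, c, ?_⟩
  simp only [cubicEval, smul_add, smul_mul_assoc, mul_smul_comm, smul_comm t]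

theorem IsCubicValue.of_isConj [DecidableEq ι] {w v : Matrix ι ι K}
    (h : IsCubicValue l1 l2 l3 m1 m2 m3 v) (hwv : IsConj w v) :
    IsCubicValue l1 l2 l3 m1 m2 m3 w := by
  obtain ⟨a, b, c, rfl⟩ := h
  obtain ⟨P, hP⟩ := hwv.symm
  have hP' : (P : Matrix ι ι K) * cubicEval l1 l2 l3 m1 m2 m3 a b c = w * P := hP
  have hw : w = P * cubicEval l1 l2 l3 m1 m2 m3 a b c * (P⁻¹ : (Matrix ι ι K)ˣ) := by
    rw [hP', mul_assoc]; simp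
  refine ⟨P * a * (P⁻¹ : (Matrix ι ι K)ˣ), P * b * (P⁻¹ : (Matrix ι ι K)ˣ),
    P * c * (P⁻¹ : (Matrix ι ι K)ˣ), ?_⟩
  rw [hw]
  simp [cubicEval, mul_add, add_mul, mul_assoc]

theorem IsCubicValue.fromBlocks {κ : Type*} [Fintype κ] {w : Matrix ι ι K} {v : Matrix κ κ K}
    (hw : IsCubicValue l1 l2 l3 m1 m2 m3 w) (hv : IsCubicValue l1 l2 l3 m1 m2 m3 v) :
    IsCubicValue l1 l2 l3 m1 m2 m3 (Matrix.fromBlocks w 0 0 v) := by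
  obtain ⟨a, b, c, rfl⟩ := hw
  obtain ⟨a', b', c', rfl⟩ := hv
  refine ⟨.fromBlocks a 0 0 a', .fromBlocks b 0 0 b', .fromBlocks c 0 0 c', ?_⟩
  simp [cubicEval, Matrix.fromBlocks_multiply, Matrix.fromBlocks_smul, Matrix.fromBlocks_add]

theorem IsCubicValue.reindex [DecidableEq ι] {κ : Type*} [Fintype κ] [DecidableEq κ]
    {w : Matrix ι ι K} (hw : IsCubicValue l1 l2 l3 m1 m2 m3 w) (e : ι ≃ κ) :
    IsCubicValue l1 l2 l3 m1 m2 m3 (Matrix.reindexAlgEquiv K K e w) := by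
  obtain ⟨a, b, c, rfl⟩ := hw
  refine ⟨Matrix.reindexAlgEquiv K K e a, Matrix.reindexAlgEquiv K K e b,
    Matrix.reindexAlgEquiv K K e c, ?_⟩
  simp only [cubicEval, map_add, map_smul, map_mul]

theorem isCubicValue_one_fin_two (hsum : l1 + l2 + l3 + m1 + m2 + m3 = 0)
    (hΛ : l1 + l2 + l3 ≠ 0) (hA : l1 + l2 + m3 ≠ 0) :
    IsCubicValue l1 l2 l3 m1 m2 m3 (1 : Matrix (Fin 2) (Fin 2) K) := by
  set s := (l1 + l2) * (m1 + m2) - m3 * l3 with hs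
  have hs0 : s ≠ 0 := by
    have : s = -((l1 + l2 + l3) * (l1 + l2 + m3)) := by
      rw [hs]; linear_combination (l1 + l2) * hsum
    rw [this]
    exact neg_ne_zero.mpr (mul_ne_zero hΛ hA)
  refine ⟨!![m1 + m2 - m3, 0; 0, l1 + l2 - l3], !![0, s⁻¹; 0, 0], !![0, 0; 1, 0], ?_⟩
  ext i j
  fin_cases i <;> fin_cases j <;> simp [cubicEval] <;>
    field_simp <;> rw [hs] <;> ring

/-- The polynomials in `u` below have a common point of nonvanishing. -/
theorem exists_nonvanishing_parameter [CharZero K] {P Q l m : K} (hsum : P + l + Q + m = 0)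
    (hΛ : P + l ≠ 0) (hA : P + m ≠ 0) :
    ∃ u : K, P * u + m ≠ 0 ∧ (m * P + Q * l - P * Q) * u + (m ^ 2 + Q ^ 2 - Q * m) ≠ 0 := by
  open Polynomial in
  have h1 : (C P * X + C m : K[X]) ≠ 0 := by
    intro h
    have c0 := congrArg (coeff · 0) h
    have c1 := congrArg (coeff · 1) h
    simp at c0 c1
    simp [c0, c1] at hA
  open Polynomial in
  have h2 : (C (m * P + Q * l - P * Q) * X + C (m ^ 2 + Q ^ 2 - Q * m) : K[X]) ≠ 0 := by
    intro h
    have c0 := congrArg (coeff · 0) h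
    have c1 := congrArg (coeff · 1) h
    simp only [coeff_add, coeff_C_mul, coeff_X_zero, coeff_X_one, coeff_C_zero, mul_zero,
      zero_add, mul_one, coeff_zero, coeff_C_succ, add_zero] at c0 c1
    have hl : l = -P - Q - m := by linear_combination hsum
    subst hl
    have hQm : Q + m ≠ 0 := by
      intro h; apply hΛ; linear_combination -h
    have : (P + m) * (m - 2 * Q) = 0 := by linear_combination c1 + c0
    rcases mul_eq_zero.mp this with h | h
    · exact hA h
    · have hm : m = 2 * Q := by linear_combination h
      subst hm
      have : (3 : K) * Q ^ 2 = 0 := by linear_combination c0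
      have hQ : Q = 0 := by simpa using this
      simp [hQ] at hQm
  obtain ⟨u, hu⟩ := Polynomial.exists_eval_ne_zero_of_natDegree_lt_card _ (mul_ne_zero h1 h2)
    ((Cardinal.natCast_lt_aleph0).trans_le (Cardinal.aleph0_le_mk K))
  simp only [Polynomial.eval_mul, Polynomial.eval_add, Polynomial.eval_C, Polynomial.eval_X] at hu
  exact ⟨u, left_ne_zero_of_mul hu, right_ne_zero_of_mul hu⟩

theorem isCubicValue_one_fin_three [CharZero K] (hsum : l1 + l2 + l3 + m1 + m2 + m3 = 0)
    (hΛ : l1 + l2 + l3 ≠ 0) (hA : l1 + l2 + m3 ≠ 0) :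
    IsCubicValue l1 l2 l3 m1 m2 m3 (1 : Matrix (Fin 3) (Fin 3) K) := by
  obtain ⟨u, ha, hκ⟩ := exists_nonvanishing_parameter (P := l1 + l2) (Q := m1 + m2) (l := l3)
    (m := m3) (by linear_combination hsum) hΛ hA
  set a := (l1 + l2) * u + m3 with ha_def
  set b := l3 * u + (m1 + m2) with hb
  set κ := (m3 * (l1 + l2) + (m1 + m2) * l3 - (l1 + l2) * (m1 + m2)) * u
    + (m3 ^ 2 + (m1 + m2) ^ 2 - (m1 + m2) * m3) with hκ_def
  have hκ' : κ = m3 * a + (b - a) * (m1 + m2) := by rw [hκ_def, hb, ha_def]; ring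
  obtain ⟨v, hv⟩ : ∃ v, v * κ = (a - b) * l3 - (l1 + l2) * a := ⟨_, div_mul_cancel₀ _ hκ⟩
  set d := (m1 + m2) * v + l3 with hd
  have hdκ : d * κ = (l1 + l2 + l3) * (l1 + l2 + m3) * a := by
    rw [hd, add_mul, mul_assoc, hv, hκ']
    linear_combination (-(l1 + l2) * a) * hsum
  have hd0 : d ≠ 0 := by
    intro h
    rw [h, zero_mul] at hdκ
    exact mul_ne_zero (mul_ne_zero hΛ hA) ha hdκ.symm
  have key : (l1 + l2 + m3 * v) * a + b * d = a * d := by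
    rw [hκ'] at hv
    rw [hd]
    linear_combination hv
  refine ⟨!![u, 0, 0; 0, 1, 0; 0, 0, v], !![0, a⁻¹, 0; 0, 0, d⁻¹; 0, 0, 0],
    !![0, 0, 0; 1, 0, 0; 0, 1, 0], ?_⟩
  ext i j
  fin_cases i <;> fin_cases j <;>
    simp [cubicEval] <;> field_simp
  · rw [ha_def]; ring
  · linear_combination -key + d * hb
  · rw [hd]; ring

theorem isCubicValue_one_fin [CharZero K] (hsum : l1 + l2 + l3 + m1 + m2 + m3 = 0)
    (hΛ : l1 + l2 + l3 ≠ 0) (hA : l1 + l2 + m3 ≠ 0) (n : ℕ) :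
    IsCubicValue l1 l2 l3 m1 m2 m3 (1 : Matrix (Fin (n + 2)) (Fin (n + 2)) K) := by
  induction n using Nat.twoStepInduction with
  | zero => exact isCubicValue_one_fin_two hsum hΛ hA
  | one => exact isCubicValue_one_fin_three hsum hΛ hA
  | more n ih _ =>
    have := (ih.fromBlocks (isCubicValue_one_fin_two hsum hΛ hA)).reindex
      (finSumFinEquiv : Fin (n + 2) ⊕ Fin 2 ≃ Fin (n + 2 + 2))
    rwa [Matrix.fromBlocks_one, map_one] at this

end

/-- A finite family of nonzero polynomials over an infinite field has a common point of
nonvanishing. -/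
theorem exists_eval_ne_zero_of_finite {K σ τ : Type*} [Field K] [Infinite K] [Fintype τ]
    (p : τ → MvPolynomial σ K) (hp : ∀ i, p i ≠ 0) :
    ∃ x : σ → K, ∀ i, MvPolynomial.eval x (p i) ≠ 0 := by
  by_contra! H
  refine Finset.prod_ne_zero_iff.mpr (fun i _ => hp i) (MvPolynomial.funext (p := ∏ i, p i)
    (q := 0) fun x => ?_)
  obtain ⟨i, hi⟩ := H x
  rw [map_prod, map_zero]
  exact Finset.prod_eq_zero (Finset.mem_univ i) hi

theorem exists_generic_diagonals {K ι : Type*} [Field K] [Infinite K] [Fintype ι]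
    [DecidableEq ι] {α β γ δ : K} (h : ¬(α = 0 ∧ β = 0 ∧ γ = 0 ∧ δ = 0)) :
    ∃ x y : ι → K, (∀ i j, i ≠ j → x i ≠ x j) ∧
      ∀ i j, i ≠ j → y i * (α * x i + β * x j) + y j * (γ * x i + δ * x j) ≠ 0 := by
  open MvPolynomial in
  let p : {q : ι × ι // q.1 ≠ q.2} ⊕ {q : ι × ι // q.1 ≠ q.2} → MvPolynomial (ι ⊕ ι) K :=
    Sum.elim (fun q => X (.inl q.1.1) - X (.inl q.1.2))
      (fun q => X (.inr q.1.1) * (C α * X (.inl q.1.1) + C β * X (.inl q.1.2)) +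
        X (.inr q.1.2) * (C γ * X (.inl q.1.1) + C δ * X (.inl q.1.2)))
  have hp : ∀ q, p q ≠ 0 := by
    rintro (⟨⟨i, j⟩, hij⟩ | ⟨⟨i, j⟩, hij⟩) h0
    · have := congrArg (MvPolynomial.eval (Sum.elim (Pi.single i 1) 0)) h0
      simp [p, Ne.symm hij] at this
    · have ev := fun u v => congrArg (MvPolynomial.eval (Sum.elim u v)) h0
      have e1 := ev (Pi.single i 1) (Pi.single i 1)
      have e2 := ev (Pi.single j 1) (Pi.single i 1)
      have e3 := ev (Pi.single i 1) (Pi.single j 1)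
      have e4 := ev (Pi.single j 1) (Pi.single j 1)
      simp [p, hij, Ne.symm hij] at e1 e2 e3 e4
      exact h ⟨e1, e2, e3, e4⟩
  obtain ⟨x, hx⟩ := exists_eval_ne_zero_of_finite p hp
  refine ⟨fun i => x (.inl i), fun i => x (.inr i), fun i j hij => ?_, fun i j hij => ?_⟩
  · simpa [p, sub_ne_zero] using hx (.inl ⟨(i, j), hij⟩)
  · simpa [p] using hx (.inr ⟨(i, j), hij⟩)

section

variable {K ι : Type*} [Field K] [Fintype ι] [DecidableEq ι] {l1 l2 l3 m1 m2 m3 : K}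

/-- The entries of a value of the polynomial at a diagonal matrix, a diagonal matrix perturbed in
one off-diagonal entry, and an arbitrary matrix. -/
theorem cubicEval_diagonal_apply (x y : ι → K) (a b : ι) (s : K) (z : Matrix ι ι K) (i j : ι) :
    cubicEval l1 l2 l3 m1 m2 m3 (Matrix.diagonal x) (Matrix.diagonal y + Matrix.single a b s) z
      i j =
    (y i * ((l1 + m3) * x i + l2 * x j) + y j * (m2 * x i + (l3 + m1) * x j)) * z i j
      + (if i = a then s * z b j * (l1 * x a + m3 * x b + l2 * x j) else 0)
      + (if j = b then s * z i a * (m2 * x i + l3 * x a + m1 * x b) else 0) := by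
  simp only [cubicEval, Matrix.add_apply, Matrix.smul_apply, smul_eq_mul, add_mul, mul_add,
    mul_assoc, Matrix.diagonal_mul, single_mul_apply_eq_ite]
  simp only [← mul_assoc, Matrix.mul_diagonal, mul_single_apply_eq_ite]
  split_ifs with h1 h2 h2
  · subst h1 h2; ring
  · subst h1; ring
  · subst h2; ring
  · ring

theorem isCubicValue_of_two_entry_diagonal (hsum : l1 + l2 + l3 + m1 + m2 + m3 = 0)
    {x y : ι → K} (hg : ∀ i j, i ≠ j →
      y i * ((l1 + m3) * x i + l2 * x j) + y j * (m2 * x i + (l3 + m1) * x j) ≠ 0)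
    {a b : ι} (hab : a ≠ b) (t : K) {D : Matrix ι ι K}
    (hD : ∀ i, D i i = if i = a then t * ((l1 + l2) * x a + m3 * x b)
      else if i = b then t * (l3 * x a + (m1 + m2) * x b) else 0) (hba : D b a ≠ 0) :
    IsCubicValue l1 l2 l3 m1 m2 m3 D := by
  set g : ι → ι → K := fun i j =>
    y i * ((l1 + m3) * x i + l2 * x j) + y j * (m2 * x i + (l3 + m1) * x j) with hg_def
  have hg' : ∀ i j, i ≠ j → g i j ≠ 0 := hg
  have hgii : ∀ i, g i i = 0 := fun i => by
    simp only [hg_def]; linear_combination (x i * y i) * hsum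
  obtain ⟨s, hs⟩ : ∃ s, s = t * g b a / D b a := ⟨_, rfl⟩
  obtain ⟨z₀, hz₀⟩ : ∃ z₀ : Matrix ι ι K, ∀ i j, z₀ i j = if i = j then 0 else D i j / g i j :=
    ⟨Matrix.of fun i j => if i = j then 0 else D i j / g i j, fun _ _ => rfl⟩
  have hsz : s * z₀ b a = t := by
    have := hg' b a hab.symm
    rw [hs, hz₀, if_neg hab.symm]
    field_simp
  obtain ⟨z, hz⟩ : ∃ z : Matrix ι ι K, ∀ i j, z i j = if i = j then 0 else (D i j
      - (if i = a then s * z₀ b j * (l1 * x a + m3 * x b + l2 * x j) else 0)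
      - (if j = b then s * z₀ i a * (m2 * x i + l3 * x a + m1 * x b) else 0)) / g i j :=
    ⟨Matrix.of fun i j => if i = j then 0 else (D i j
      - (if i = a then s * z₀ b j * (l1 * x a + m3 * x b + l2 * x j) else 0)
      - (if j = b then s * z₀ i a * (m2 * x i + l3 * x a + m1 * x b) else 0)) / g i j,
      fun _ _ => rfl⟩
  have hzb : ∀ j, z b j = z₀ b j := by
    intro j
    rw [hz b j, hz₀ b j]
    by_cases hj : b = j
    · simp [hj]
    · simp [hj, hab.symm, Ne.symm hj]
  have hza : ∀ i, z i a = z₀ i a := by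
    intro i
    rw [hz i a, hz₀ i a]
    by_cases hi : i = a
    · simp [hi]
    · simp [hi, hab]
  refine ⟨Matrix.diagonal x, Matrix.diagonal y + Matrix.single a b s, z, ?_⟩
  ext i j
  rw [cubicEval_diagonal_apply, hzb, hza]
  change D i j = g i j * z i j + _ + _
  by_cases hij : i = j
  · subst hij
    rw [hgii, hD]
    by_cases hia : i = a
    · subst hia
      simp only [if_true, if_neg hab]
      rw [hsz]; ring
    · by_cases hib : i = b
      · subst hib
        simp only [if_true, if_neg hia]
        rw [hsz]; ring
      · simp [hia, hib]
  · rw [hz, if_neg hij, mul_div_cancel₀ _ (hg' i j hij)]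
    ring

theorem isCubicValue_of_not_mem_range_scalar [Infinite K]
    (hsum : l1 + l2 + l3 + m1 + m2 + m3 = 0)
    (hG : ¬(l1 + m3 = 0 ∧ l2 = 0 ∧ m2 = 0 ∧ l3 + m1 = 0)) {a b : ι} (hab : a ≠ b)
    (H : HasTwoEntryDiagonalForm K a b) {A : Matrix ι ι K}
    (hA : A ∉ Set.range (Matrix.scalar ι)) (htr : l1 + l2 + l3 = 0 → A.trace = 0) :
    IsCubicValue l1 l2 l3 m1 m2 m3 A := by
  obtain ⟨x, y, hx, hg⟩ := exists_generic_diagonals (ι := ι) hG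
  obtain ⟨t, ht⟩ : ∃ t, t * ((l1 + l2 + l3) * (x a - x b)) = A.trace := by
    by_cases hΛ : l1 + l2 + l3 = 0
    · exact ⟨0, by rw [htr hΛ, zero_mul]⟩
    · exact ⟨_, div_mul_cancel₀ _ (mul_ne_zero hΛ (sub_ne_zero.mpr (hx a b hab)))⟩
  obtain ⟨D, hAD, hD, hba⟩ := H A hA (t * ((l1 + l2) * x a + m3 * x b))
    (t * (l3 * x a + (m1 + m2) * x b)) (by
      rw [← ht]; linear_combination (t * x b) * hsum)
  exact (isCubicValue_of_two_entry_diagonal hsum hg hab t hD hba).of_isConj hAD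

end

theorem trace_cubicEval {K ι : Type*} [Field K] [Fintype ι] {l1 l2 l3 m1 m2 m3 : K}
    (hsum : l1 + l2 + l3 + m1 + m2 + m3 = 0) (hΛ : l1 + l2 + l3 = 0)
    (a b c : Matrix ι ι K) : (cubicEval l1 l2 l3 m1 m2 m3 a b c).trace = 0 := by
  have h1 : (b * c * a).trace = (a * b * c).trace := by
    rw [Matrix.trace_mul_comm, mul_assoc]
  have h2 : (c * a * b).trace = (a * b * c).trace := by
    rw [mul_assoc, Matrix.trace_mul_comm]
  have h3 : (a * c * b).trace = (c * b * a).trace := by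
    rw [mul_assoc, Matrix.trace_mul_comm]
  have h4 : (b * a * c).trace = (c * b * a).trace := by
    rw [Matrix.trace_mul_comm, mul_assoc]
  simp only [cubicEval, Matrix.trace_add, Matrix.trace_smul, smul_eq_mul, h1, h2, h3, h4]
  linear_combination (a * b * c).trace * hΛ + (c * b * a).trace * (hsum - hΛ)

theorem isCubicValue_fin {K : Type*} [Field K] [CharZero K] {l1 l2 l3 m1 m2 m3 : K}
    (hsum : l1 + l2 + l3 + m1 + m2 + m3 = 0)
    (hf : ¬(l1 = 0 ∧ l2 = 0 ∧ l3 = 0 ∧ m1 = 0 ∧ m2 = 0 ∧ m3 = 0)) {n : ℕ}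
    {A : Matrix (Fin (n + 2)) (Fin (n + 2)) K} (htr : l1 + l2 + l3 = 0 → A.trace = 0) :
    IsCubicValue l1 l2 l3 m1 m2 m3 A := by
  have hsum1 : l2 + l3 + l1 + m2 + m3 + m1 = 0 := by linear_combination hsum
  have hsum2 : l3 + l1 + l2 + m3 + m1 + m2 = 0 := by linear_combination hsum
  have e1 : l2 + l3 + l1 = l1 + l2 + l3 := by ring
  have e2 : l3 + l1 + l2 = l1 + l2 + l3 := by ring
  by_cases hA : A ∈ Set.range (Matrix.scalar (Fin (n + 2)))
  · obtain ⟨c, rfl⟩ := hA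
    have hc : Matrix.scalar (Fin (n + 2)) c = c • (1 : Matrix (Fin (n + 2)) (Fin (n + 2)) K) := by
      simp [Matrix.smul_one_eq_diagonal]
    by_cases hΛ : l1 + l2 + l3 = 0
    · have h := htr hΛ
      rw [hc, Matrix.trace_smul, Matrix.trace_one, Fintype.card_fin, smul_eq_mul] at h
      have hn : ((n + 2 : ℕ) : K) ≠ 0 := by exact_mod_cast (by omega : n + 2 ≠ 0)
      have hc0 : c = 0 := (mul_eq_zero.mp h).resolve_right hn
      refine ⟨0, 0, 0, ?_⟩
      simp [hc0, cubicEval]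
    · rw [hc]
      refine IsCubicValue.smul ?_ c
      by_cases h0 : l1 + l2 + m3 = 0
      · by_cases h1 : l2 + l3 + m1 = 0
        · have h2 : l3 + l1 + m2 ≠ 0 := by
            intro h2
            apply hΛ
            linear_combination h0 + h1 + h2 - hsum
          exact (isCubicValue_one_fin hsum2 (e2 ▸ hΛ) h2 n).rotate.rotate
        · exact (isCubicValue_one_fin hsum1 (e1 ▸ hΛ) h1 n).rotate
      · exact isCubicValue_one_fin hsum hΛ h0 n
  · obtain ⟨a, b, hab, H⟩ := exists_hasTwoEntryDiagonalForm_fin K n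
    by_cases h0 : l1 + m3 = 0 ∧ l2 = 0 ∧ m2 = 0 ∧ l3 + m1 = 0
    · by_cases h1 : l2 + m1 = 0 ∧ l3 = 0 ∧ m3 = 0 ∧ l1 + m2 = 0
      · obtain ⟨h01, h02, h03, -⟩ := h0
        obtain ⟨h11, h12, h13, -⟩ := h1
        exact absurd ⟨by simpa [h13] using h01, h02, h12, by simpa [h02] using h11, h03, h13⟩ hf
      · exact (isCubicValue_of_not_mem_range_scalar hsum1 h1 hab H hA (e1 ▸ htr)).rotate
    · exact isCubicValue_of_not_mem_range_scalar hsum h0 hab H hA htr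

/-- L'vov–Kaplansky conjecture for multilinear polynomials of degree three:
over an algebraically closed field of characteristic 0, the image of
`f(x,y,z) = λ₁xyz + λ₂yzx + λ₃zxy + μ₁zyx + μ₂xzy + μ₃yxz` in `Mₙ(K)`
is a vector subspace. -/
theorem image_of_multilinear_deg_three_is_subspace
    (K : Type*) [Field K] [IsAlgClosed K] [CharZero K]
    (n : ℕ) (hn : 1 ≤ n) (l1 l2 l3 m1 m2 m3 : K) :
    ∃ V : Submodule K (Matrix (Fin n) (Fin n) K),
      (V : Set (Matrix (Fin n) (Fin n) K)) =
        {w : Matrix (Fin n) (Fin n) K | ∃ a b c : Matrix (Fin n) (Fin n) K,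
          w = l1 • (a * b * c) + l2 • (b * c * a) + l3 • (c * a * b)
            + m1 • (c * b * a) + m2 • (a * c * b) + m3 • (b * a * c)} := by
  suffices h : ∃ V : Submodule K (Matrix (Fin n) (Fin n) K),
      ∀ w, w ∈ V ↔ IsCubicValue l1 l2 l3 m1 m2 m3 w from
    h.imp fun V hV => Set.ext hV
  by_cases hsum : l1 + l2 + l3 + m1 + m2 + m3 = 0
  · by_cases hf : l1 = 0 ∧ l2 = 0 ∧ l3 = 0 ∧ m1 = 0 ∧ m2 = 0 ∧ m3 = 0
    · obtain ⟨rfl, rfl, rfl, rfl, rfl, rfl⟩ := hf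
      exact ⟨⊥, fun w => by simp [IsCubicValue, cubicEval]⟩
    · obtain rfl | ⟨n, rfl⟩ : n = 1 ∨ ∃ k, n = k + 2 := by
        rcases n with _ | _ | n
        · omega
        · exact .inl rfl
        · exact .inr ⟨n, rfl⟩
      · refine ⟨⊥, fun w => ⟨?_, ?_⟩⟩
        · intro hw
          rw [Submodule.mem_bot] at hw
          exact ⟨0, 0, 0, by simp [hw, cubicEval]⟩
        · rintro ⟨a, b, c, rfl⟩
          rw [Submodule.mem_bot]
          ext i j
          fin_cases i
          fin_cases j
          simp [cubicEval, Matrix.mul_apply]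
          linear_combination (a 0 0 * b 0 0 * c 0 0) * hsum
      · by_cases hΛ : l1 + l2 + l3 = 0
        · refine ⟨LinearMap.ker (Matrix.traceLinearMap (Fin (n + 2)) K K), fun w => ⟨?_, ?_⟩⟩
          · intro hw
            exact isCubicValue_fin hsum hf fun _ => by simpa using hw
          · rintro ⟨a, b, c, rfl⟩
            simpa using trace_cubicEval hsum hΛ a b c
        · exact ⟨⊤, fun w => ⟨fun _ => isCubicValue_fin hsum hf fun h => absurd h hΛ,
            fun _ => Submodule.mem_top⟩⟩
  · refine ⟨⊤, fun w => ⟨fun _ => ?_, fun _ => Submodule.mem_top⟩⟩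
    refine ⟨1, 1, (l1 + l2 + l3 + m1 + m2 + m3)⁻¹ • w, ?_⟩
    simp only [cubicEval, mul_one, one_mul, ← add_smul, smul_smul]
    rw [← add_mul, ← add_mul, ← add_mul, ← add_mul, ← add_mul, mul_inv_cancel₀ hsum, one_smul]
end

section
/- Let n ≥ 4 be a natural number and let F be a field of characteristic different from 2 and 3 such that for any n-th roots of unity ω, η, θ ∈ F, each distinct from 1, one has ωηθ − ω − η − θ + 2 ≠ 0. Let λ₁, λ₂, λ₃, μ₁, μ₂, μ₃ ∈ F, not all zero, and let f(x,y,z) = λ₁xyz + λ₂yzx + λ₃zxy + μ₁zyx + μ₂xzy + μ₃yxz. If K is an algebraically closed field extension of F (via a ring homomorphism F → K used to map the coefficients), then the image of f in Mₙ(K), i.e. { f(a,b,c) : a, b, c ∈ Mₙ(K) }, equals either slₙ(K) (the set of trace-zero matrices) or all of Mₙ(K). -/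
open Module
open scoped Matrix

theorem LinearIndependent.exists_dual_apply_eq {K V ι : Type*} [Field K] [AddCommGroup V]
    [Module K V] {g : ι → V} (hg : LinearIndependent K g) (c : ι → K) :
    ∃ φ : V →ₗ[K] K, ∀ i, φ (g i) = c i := by
  obtain ⟨φ, hφ⟩ := LinearMap.exists_extend ((Basis.span hg).constr K c)
  refine ⟨φ, fun i => ?_⟩
  have h := LinearMap.congr_fun hφ (Basis.span hg i)
  rwa [LinearMap.comp_apply, Basis.constr_basis, Submodule.subtype_apply, Basis.span_apply] at h

/-- The compression of `f` to the kernel of `φ` along `v`, where `φ v = 1`. -/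
def compression {K V : Type*} [Field K] [AddCommGroup V] [Module K V] (f : V →ₗ[K] V)
    (φ : V →ₗ[K] K) (v : V) (hv : φ v = 1) : LinearMap.ker φ →ₗ[K] LinearMap.ker φ :=
  LinearMap.codRestrict (LinearMap.ker φ)
    ((f - (φ ∘ₗ f).smulRight v) ∘ₗ (LinearMap.ker φ).subtype)
    (fun y => by simp [hv])

theorem coe_compression {K V : Type*} [Field K] [AddCommGroup V] [Module K V] (f : V →ₗ[K] V)
    (φ : V →ₗ[K] K) (v : V) (hv : φ v = 1) (y : LinearMap.ker φ) :
    (compression f φ v hv y : V) = f y - φ (f y) • v :=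
  rfl

theorem exists_functional_compression_not_scalar {K V : Type*} [Field K] [AddCommGroup V]
    [Module K V] [FiniteDimensional K V] (f : V →ₗ[K] V) (hf : ¬ ∃ σ : K, ∀ y, f y = σ • y)
    (e : K) : ∃ (v : V) (φ : V →ₗ[K] K) (hv : φ v = 1), φ (f v) = e ∧
      (2 < finrank K V → ¬ ∃ σ : K, ∀ y, compression f φ v hv y = σ • y) := by
  obtain ⟨v, hli⟩ : ∃ v, LinearIndependent K ![v, f v] := by
    by_contra! h
    obtain ⟨σ, hσ⟩ := LinearMap.exists_eq_smul_id_of_forall_notLinearIndependent h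
    exact hf ⟨σ, fun y => by rw [hσ]; simp⟩
  obtain ⟨φ, hφ⟩ := hli.exists_dual_apply_eq ![1, e]
  have hv : φ v = 1 := hφ 0
  have hfv : φ (f v) = e := hφ 1
  by_cases hs : ∃ σ : K, ∀ y, compression f φ v hv y = σ • y
  swap
  · exact ⟨v, φ, hv, hfv, fun _ => hs⟩
  by_cases hdim : 2 < finrank K V
  swap
  · exact ⟨v, φ, hv, hfv, fun h => absurd h hdim⟩
  obtain ⟨σ, hσ⟩ := hs
  set S := Submodule.span K (Set.range ![v, f v]) with hS
  have hvS : v ∈ S := Submodule.subset_span ⟨0, rfl⟩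
  have hfvS : f v ∈ S := Submodule.subset_span ⟨1, rfl⟩
  obtain ⟨x, hx⟩ : ∃ x, x ∉ S := by
    by_contra! h
    have htop : S = ⊤ := by ext y; simp [h y]
    have h2 := finrank_span_eq_card hli
    rw [← hS, htop, finrank_top] at h2
    simp at h2
    omega
  obtain ⟨η, hηx, hηS⟩ := Submodule.exists_le_ker_of_notMem hx
  have hηv : η v = 0 := hηS hvS
  have hηfv : η (f v) = 0 := hηS hfvS
  have hv' : (φ + η) v = 1 := by simp [hv, hηv]
  refine ⟨v, φ + η, hv', by simp [hfv, hηfv], fun _ => ?_⟩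
  rintro ⟨τ, hτ⟩
  have key : ∀ y, φ y = 0 → ∃ r : K, η y • (f v - e • v) = (σ - τ) • y + r • v := by
    intro y hy
    have h1 := congrArg Subtype.val (hσ ⟨y, hy⟩)
    have h2 := congrArg Subtype.val (hτ ⟨y - η y • v, by simp [hy, hv, hηv]⟩)
    rw [coe_compression] at h1 h2
    simp only [map_sub, map_smul, SetLike.val_smul] at h1 h2
    refine ⟨φ (f y) - e * η y - ((φ + η) (f y) - η y • (φ + η) (f v)) + τ * η y, ?_⟩
    have h3 : f y = σ • y + φ (f y) • v := by rw [← h1]; abel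
    have h4 : f y = τ • (y - η y • v) + η y • f v
      + ((φ + η) (f y) - η y • (φ + η) (f v)) • v := by rw [← h2]; abel
    have h5 := h3.symm.trans h4
    generalize (φ + η) (f y) - η y • (φ + η) (f v) = q at h5 ⊢
    generalize φ (f y) = q' at h5 ⊢
    have h6 : η y • f v = σ • y + q' • v - τ • (y - η y • v) - q • v := by rw [h5]; abel
    rw [smul_sub, h6]
    module
  have hpair := LinearIndependent.pair_iff.1 hli
  have hστ : σ - τ = 0 := by
    obtain ⟨r, hr⟩ := key (f v - e • v) (by simp [hfv, hv])
    have h0 : η (f v - e • v) = 0 := by simp [hηfv, hηv]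
    rw [h0, zero_smul] at hr
    exact (hpair (r - (σ - τ) * e) (σ - τ) (by rw [hr]; module)).2
  obtain ⟨r, hr⟩ := key (x - φ x • v) (by simp [hv])
  rw [hστ] at hr
  have h0 : η (x - φ x • v) = η x := by simp [hηv]
  rw [h0] at hr
  refine hηx (hpair (- η x * e - r) (η x) ?_).2
  have : η x • f v = r • v + (η x * e) • v := by
    rw [zero_smul, zero_add] at hr
    rw [← hr]; module
  rw [this]; module

theorem exists_dual_bases_diag_eq {K : Type*} [Field K] (n : ℕ) :
    ∀ (V : Type*) [AddCommGroup V] [Module K V] [FiniteDimensional K V]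
      (_ : finrank K V = n + 1) (f : V →ₗ[K] V)
      (_ : 0 < n → ¬ ∃ σ : K, ∀ y, f y = σ • y) (e : Fin n → K),
    ∃ (b : Fin (n + 1) → V) (φ : Fin (n + 1) → V →ₗ[K] K),
      (∀ i j, φ i (b j) = if i = j then 1 else 0) ∧
      ∀ i : Fin n, φ i.castSucc (f (b i.castSucc)) = e i := by
  induction n with
  | zero =>
    intro V _ _ _ hV f _ e
    let B := finBasisOfFinrankEq K V hV
    refine ⟨B, B.coord, fun i j => ?_, fun i => i.elim0⟩
    rw [Basis.coord_apply, Basis.repr_self, Finsupp.single_apply]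
    simp [eq_comm]
  | succ n ih =>
    intro V _ _ _ hV f hf e
    obtain ⟨v, φ, hv, hfv, hns⟩ :=
      exists_functional_compression_not_scalar f (hf n.succ_pos) (e 0)
    have hker : finrank K (LinearMap.ker φ) = n + 1 := by
      have h1 := LinearMap.finrank_range_add_finrank_ker φ
      have h2 : LinearMap.range φ = ⊤ := by
        refine LinearMap.range_eq_top.2 fun c => ⟨c • v, by simp [hv]⟩
      rw [h2, finrank_top, finrank_self] at h1
      omega
    obtain ⟨b, ψ, hbψ, hd⟩ := ih (LinearMap.ker φ) hker (compression f φ v hv)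
      (fun h => hns (by omega)) (fun i => e i.succ)
    let π : V →ₗ[K] LinearMap.ker φ := LinearMap.codRestrict (LinearMap.ker φ)
      (LinearMap.id - φ.smulRight v) (fun y => by simp [hv])
    have hπv : π v = 0 := Subtype.ext (show v - φ v • v = 0 by simp [hv])
    have hπ : ∀ y : LinearMap.ker φ, π y = y := fun y =>
      Subtype.ext (show (y : V) - φ y • v = y by simp)
    have hπf : ∀ y : LinearMap.ker φ, π (f y) = compression f φ v hv y := fun y => rfl
    refine ⟨Fin.cons v fun i => (b i : V), Fin.cons φ fun i => ψ i ∘ₗ π, ?_, ?_⟩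
    · intro i j
      refine Fin.cases ?_ (fun i => ?_) i <;> refine Fin.cases ?_ (fun j => ?_) j
      · simp [hv]
      · simp [(Fin.succ_ne_zero j).symm]
      · simp [hπv, Fin.succ_ne_zero]
      · simp [hπ, hbψ]
    · intro i
      refine Fin.cases ?_ (fun i => ?_) i
      · simpa using hfv
      · simp only [Fin.castSucc_succ, Fin.cons_succ, LinearMap.comp_apply, hπf, hd]

theorem Matrix.exists_conj_diag_eq {K : Type*} [Field K] {n : ℕ} (w : Matrix (Fin n) (Fin n) K)
    (hw : ¬ ∃ σ : K, w = Matrix.scalar (Fin n) σ) (e : Fin n → K) (he : ∑ i, e i = w.trace) :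
    ∃ P Q : Matrix (Fin n) (Fin n) K, Q * P = 1 ∧ ∀ i, (P * w * Q) i i = e i := by
  obtain _ | n := n
  · exact absurd ⟨0, Subsingleton.elim _ _⟩ hw
  obtain ⟨b, φ, hbφ, hd⟩ := exists_dual_bases_diag_eq n (Fin (n + 1) → K) (by simp)
    (Matrix.toLin' w) (fun _ ⟨σ, hσ⟩ => hw ⟨σ, by
      apply Matrix.toLin'.injective
      ext i j
      simp [hσ, Pi.single_apply, eq_comm]⟩) (fun i => e i.castSucc)
  let P : Matrix (Fin (n + 1)) (Fin (n + 1)) K := LinearMap.toMatrix' (LinearMap.pi φ)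
  let Q : Matrix (Fin (n + 1)) (Fin (n + 1)) K := Matrix.of fun i j => b j i
  have hQ : ∀ j, Q *ᵥ Pi.single j 1 = b j := fun j => by
    ext i; simp [Q]
  have hP : ∀ x i, (P *ᵥ x) i = φ i x := fun x i => by
    simp only [P, LinearMap.toMatrix'_mulVec, LinearMap.pi_apply]
  have hent : ∀ (A : Matrix (Fin (n + 1)) (Fin (n + 1)) K) i j,
      (P * A * Q) i j = φ i (A *ᵥ b j) := fun A i j => by
    rw [← hP, ← hQ, Matrix.mulVec_mulVec, Matrix.mulVec_mulVec, Matrix.mulVec_single_one,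
      Matrix.mul_assoc]
    rfl
  have hPQ : P * Q = 1 := by
    ext i j
    have h := hent 1 i j
    rw [Matrix.mul_one, Matrix.one_mulVec] at h
    rw [h, hbφ, Matrix.one_apply]
  have hQP := mul_eq_one_comm.1 hPQ
  have hcs : ∀ i : Fin n, (P * w * Q) i.castSucc i.castSucc = e i.castSucc := fun i => by
    rw [hent, ← hd, Matrix.toLin'_apply]
  refine ⟨P, Q, hQP, fun i => ?_⟩
  refine Fin.lastCases ?_ hcs i
  have htr : (P * w * Q).trace = w.trace := by
    rw [Matrix.trace_mul_comm, ← Matrix.mul_assoc, hQP, Matrix.one_mul]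
  rw [← he, Matrix.trace, Fin.sum_univ_castSucc, Fin.sum_univ_castSucc] at htr
  simp only [Matrix.diag_apply, hcs] at htr
  exact add_left_cancel htr

/-- The values of the multilinear polynomial
`l1 xyz + l2 yzx + l3 zxy + m1 zyx + m2 xzy + m3 yxz` on square matrices indexed by `ι`. -/
def cubicImage {K : Type*} [Field K] (ι : Type*) [Fintype ι] (l1 l2 l3 m1 m2 m3 : K) :
    Set (Matrix ι ι K) :=
  {w | ∃ a b c : Matrix ι ι K,
    w = l1 • (a * b * c) + l2 • (b * c * a) + l3 • (c * a * b)
      + m1 • (c * b * a) + m2 • (a * c * b) + m3 • (b * a * c)}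

section CubicImage

variable {K : Type*} [Field K] {ι κ : Type*} [Fintype ι] [Fintype κ] {l1 l2 l3 m1 m2 m3 : K}

theorem cubicImage_rotate :
    cubicImage ι l2 l3 l1 m2 m3 m1 = cubicImage ι l1 l2 l3 m1 m2 m3 := by
  ext w
  constructor
  · rintro ⟨a, b, c, rfl⟩
    exact ⟨c, a, b, by abel⟩
  · rintro ⟨a, b, c, rfl⟩
    exact ⟨b, c, a, by abel⟩

theorem smul_mem_cubicImage {w : Matrix ι ι K} (t : K)
    (hw : w ∈ cubicImage ι l1 l2 l3 m1 m2 m3) : t • w ∈ cubicImage ι l1 l2 l3 m1 m2 m3 := by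
  obtain ⟨a, b, c, rfl⟩ := hw
  refine ⟨t • a, b, c, ?_⟩
  simp only [smul_mul_assoc, mul_smul_comm, smul_add]
  simp only [smul_comm t]

theorem mem_cubicImage_of_conj [DecidableEq ι] {w P Q : Matrix ι ι K} (hQP : Q * P = 1)
    (hw : P * w * Q ∈ cubicImage ι l1 l2 l3 m1 m2 m3) :
    w ∈ cubicImage ι l1 l2 l3 m1 m2 m3 := by
  obtain ⟨a, b, c, h⟩ := hw
  have hPQ : P * Q = 1 := mul_eq_one_comm.1 hQP
  have hw : w = Q * (P * w * Q) * P := by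
    rw [← mul_assoc, ← mul_assoc, hQP, one_mul, mul_assoc, hQP, mul_one]
  have key : ∀ x y z : Matrix ι ι K,
      Q * x * P * (Q * y * P) * (Q * z * P) = Q * (x * y * z) * P := fun x y z =>
    calc Q * x * P * (Q * y * P) * (Q * z * P)
        = Q * x * (P * Q) * y * (P * Q) * z * P := by simp only [mul_assoc]
      _ = Q * (x * y * z) * P := by rw [hPQ]; simp only [mul_assoc, one_mul]
  refine ⟨Q * a * P, Q * b * P, Q * c * P, ?_⟩
  simp only [key]
  rw [hw, h]
  simp only [mul_add, add_mul, mul_smul_comm, smul_mul_assoc]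

theorem trace_of_mem_cubicImage {w : Matrix ι ι K} (hl : l1 + l2 + l3 = 0)
    (hm : m1 + m2 + m3 = 0) (hw : w ∈ cubicImage ι l1 l2 l3 m1 m2 m3) : w.trace = 0 := by
  obtain ⟨a, b, c, rfl⟩ := hw
  simp only [Matrix.trace_add, Matrix.trace_smul, smul_eq_mul]
  rw [Matrix.trace_mul_cycle b c a, Matrix.trace_mul_cycle a c b, Matrix.trace_mul_cycle b a c,
    ← Matrix.trace_mul_cycle a b c]
  linear_combination (a * b * c).trace * hl + (c * b * a).trace * hm

theorem fromBlocks_mem_cubicImage {v : Matrix ι ι K} {w : Matrix κ κ K}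
    (hv : v ∈ cubicImage ι l1 l2 l3 m1 m2 m3) (hw : w ∈ cubicImage κ l1 l2 l3 m1 m2 m3) :
    Matrix.fromBlocks v 0 0 w ∈ cubicImage (ι ⊕ κ) l1 l2 l3 m1 m2 m3 := by
  obtain ⟨a, b, c, rfl⟩ := hv
  obtain ⟨a', b', c', rfl⟩ := hw
  refine ⟨Matrix.fromBlocks a 0 0 a', Matrix.fromBlocks b 0 0 b', Matrix.fromBlocks c 0 0 c', ?_⟩
  simp [Matrix.fromBlocks_multiply, Matrix.fromBlocks_smul, Matrix.fromBlocks_add]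

theorem submatrix_mem_cubicImage {w : Matrix ι ι K} (e : κ ≃ ι)
    (hw : w ∈ cubicImage ι l1 l2 l3 m1 m2 m3) :
    w.submatrix e e ∈ cubicImage κ l1 l2 l3 m1 m2 m3 := by
  obtain ⟨a, b, c, rfl⟩ := hw
  refine ⟨a.submatrix e e, b.submatrix e e, c.submatrix e e, ?_⟩
  simp only [Matrix.submatrix_mul_equiv]
  rfl

theorem one_mem_cubicImage_two (hα : l1 + l2 + m3 ≠ 0) (hl : l1 + l2 + l3 ≠ 0)
    (hm : m1 + m2 + m3 = -(l1 + l2 + l3)) :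
    (1 : Matrix (Fin 2) (Fin 2) K) ∈ cubicImage (Fin 2) l1 l2 l3 m1 m2 m3 := by
  refine ⟨!![l1 + l2 + l3 + 2 * m3, 0; 0, l1 + l2 + l3 - 2 * (l1 + l2)], !![0, 1; 0, 0],
    !![0, 0; ((l1 + l2 + l3) * (l1 + l2 + m3))⁻¹, 0], ?_⟩
  have hne : (l1 + l2 + l3) * (l1 + l2 + m3) ≠ 0 := mul_ne_zero hl hα
  obtain rfl : m1 = -(l1 + l2 + l3) - m2 - m3 := by linear_combination hm
  ext i j
  fin_cases i <;> fin_cases j <;> simp <;> field_simp <;> ring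

theorem one_mem_cubicImage_three [Infinite K] (hα : l1 + l2 + m3 ≠ 0) (hl : l1 + l2 + l3 ≠ 0)
    (hm : m1 + m2 + m3 = -(l1 + l2 + l3)) :
    (1 : Matrix (Fin 3) (Fin 3) K) ∈ cubicImage (Fin 3) l1 l2 l3 m1 m2 m3 := by
  obtain ⟨Λ, hΛ⟩ : ∃ Λ, Λ = l1 + l2 + l3 := ⟨_, rfl⟩
  obtain ⟨p, hp⟩ : ∃ p, p = l1 + l2 := ⟨_, rfl⟩
  classical
  obtain ⟨s, hs⟩ := Infinite.exists_notMem_finset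
    ({(Λ - p) / p, (Λ + 2 * m3) / (Λ + m3)} : Finset K)
  simp only [Finset.mem_insert, Finset.mem_singleton, not_or] at hs
  rw [← hΛ] at hl hm
  rw [← hp] at hα
  have hD1 : Λ - (1 + s) * p ≠ 0 := by
    intro h
    by_cases hp0 : p = 0
    · exact hl (by rw [hp0] at h; linear_combination h)
    · exact hs.1 (by rw [eq_div_iff hp0]; linear_combination -h)
  have hD3 : (1 - s) * Λ + (2 - s) * m3 ≠ 0 := by
    intro h
    by_cases hr : Λ + m3 = 0
    · exact hl (by linear_combination -h + (2 - s) * hr)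
    · exact hs.2 (by rw [eq_div_iff hr]; linear_combination -h)
  obtain ⟨D1, hD1'⟩ : ∃ D1, D1 = Λ - (1 + s) * p := ⟨_, rfl⟩
  obtain ⟨D3, hD3'⟩ : ∃ D3, D3 = (1 - s) * Λ + (2 - s) * m3 := ⟨_, rfl⟩
  rw [← hD1'] at hD1
  rw [← hD3'] at hD3
  obtain rfl : m1 = -Λ - m2 - m3 := by linear_combination hm
  obtain rfl : l1 = p - l2 := by linear_combination -hp
  obtain rfl : l3 = Λ - p := by linear_combination -hΛ
  refine ⟨!![(Λ + (1 + s) * m3) * D3, 0, 0; 0, D1 * D3, 0; 0, 0, ((1 - s) * Λ - (2 - s) * p) * D1],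
    !![0, 1, 0; 0, 0, 1; 0, 0, 0],
    !![0, 0, 0; (D3 * Λ * (p + m3))⁻¹, 0, 0; 0, (D1 * Λ * (p + m3))⁻¹, 0], ?_⟩
  ext i j
  fin_cases i <;> fin_cases j <;> simp
  · field_simp
    rw [hD1']; ring
  · field_simp
    rw [hD1', hD3']; ring
  · field_simp
    rw [hD3']; ring

theorem one_mem_cubicImage [Infinite K] (hα : l1 + l2 + m3 ≠ 0) (hl : l1 + l2 + l3 ≠ 0)
    (hm : m1 + m2 + m3 = -(l1 + l2 + l3)) (n : ℕ) :
    (1 : Matrix (Fin (n + 2)) (Fin (n + 2)) K) ∈ cubicImage (Fin (n + 2)) l1 l2 l3 m1 m2 m3 := by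
  induction n using Nat.twoStepInduction with
  | zero => exact one_mem_cubicImage_two hα hl hm
  | one => exact one_mem_cubicImage_three hα hl hm
  | more n ih _ =>
    have h := submatrix_mem_cubicImage finSumFinEquiv.symm
      (fromBlocks_mem_cubicImage ih (one_mem_cubicImage_two hα hl hm))
    rwa [Matrix.fromBlocks_one, Matrix.submatrix_one_equiv] at h

end CubicImage

section Commutators

variable {K : Type*} [Field K] {n : ℕ}

theorem Matrix.exists_commutator_eq_one (hn : (n : K) = 0) :
    ∃ x y : Matrix (Fin n) (Fin n) K, x * y - y * x = 1 := by
  refine ⟨Matrix.of fun i j => if (i : ℕ) + 1 = j then ((j : ℕ) : K) else 0,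
    Matrix.of fun i j => if (i : ℕ) = j + 1 then 1 else 0, ?_⟩
  have h1 : ∀ i j : Fin n, (∑ k : Fin n, (if (i : ℕ) + 1 = k then ((k : ℕ) : K) else 0) *
      (if (k : ℕ) = j + 1 then 1 else 0)) = if i = j then ((i : ℕ) : K) + 1 else 0 := by
    intro i j
    by_cases hi : (i : ℕ) + 1 < n
    · rw [Finset.sum_eq_single ⟨i + 1, hi⟩]
      · simp [Fin.ext_iff]
      · intro k _ hk
        rw [if_neg (fun h => hk (Fin.ext h.symm)), zero_mul]
      · simp
    · have hin : (i : ℕ) + 1 = n := by have := i.2; omega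
      rw [Finset.sum_eq_zero]
      · have : ((i : ℕ) : K) + 1 = 0 := by
          rw [← hn, ← Nat.cast_succ]; exact congrArg Nat.cast hin
        simp [this]
      · intro k _
        rw [if_neg (by have := k.2; omega), zero_mul]
  have h2 : ∀ i j : Fin n, (∑ k : Fin n, (if (i : ℕ) = k + 1 then (1 : K) else 0) *
      (if (k : ℕ) + 1 = j then ((j : ℕ) : K) else 0)) = if i = j then ((i : ℕ) : K) else 0 := by
    intro i j
    by_cases hi : (i : ℕ) = 0
    · rw [Finset.sum_eq_zero]
      · simp [hi]
      · intro k _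
        rw [if_neg (by omega), zero_mul]
    · have hlt : (i : ℕ) - 1 < n := by have := i.2; omega
      have hi1 : (i : ℕ) - 1 + 1 = i := by omega
      rw [Finset.sum_eq_single ⟨i - 1, hlt⟩]
      · simp only [hi1, if_true, one_mul, Fin.ext_iff]
        split_ifs with h
        · rw [h]
        · rfl
      · intro k _ hk
        rw [if_neg (fun h => hk (Fin.ext (by simp [h]))), zero_mul]
      · simp
  ext i j
  simp only [Matrix.sub_apply, Matrix.mul_apply, Matrix.of_apply, h1, h2, Matrix.one_apply]
  split_ifs <;> ring

/-- An injective diagonal lets one divide a matrix with zero diagonal by its commutator. -/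
theorem Matrix.exists_commutator_diagonal_eq {β : Fin n → K} (hβ : Function.Injective β)
    {w : Matrix (Fin n) (Fin n) K} (hw : ∀ i, w i i = 0) :
    ∃ c : Matrix (Fin n) (Fin n) K, (∀ i, c i i = 0) ∧
      Matrix.diagonal β * c - c * Matrix.diagonal β = w := by
  refine ⟨Matrix.of fun i j => w i j / (β i - β j), fun i => by simp [hw], ?_⟩
  ext i j
  rw [Matrix.sub_apply, Matrix.diagonal_mul, Matrix.mul_diagonal, Matrix.of_apply]
  by_cases hij : i = j
  · subst hij; simp [hw]
  · have : β i - β j ≠ 0 := sub_ne_zero.2 fun h => hij (hβ h)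
    field_simp

theorem exists_injective_forall_notMem {K : Type*} [Infinite K] (S : Finset K) :
    ∃ β : Fin n → K, Function.Injective β ∧ ∀ i, β i ∉ S := by
  have : Infinite {x : K // x ∉ S} := (Set.Finite.infinite_compl S.finite_toSet).to_subtype
  let g := Infinite.natEmbedding {x : K // x ∉ S}
  exact ⟨fun i => g i, fun i j h => Fin.ext (g.injective (Subtype.ext h)), fun i => (g i).2⟩

theorem Matrix.scalar_eq_zero_or_natCast_eq_zero {σ : K}
    (h : (Matrix.scalar (Fin n) σ).trace = 0) : σ = 0 ∨ (n : K) = 0 := by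
  simpa [or_comm] using h

variable [Infinite K] {l1 l2 l3 m1 m2 m3 : K} {w : Matrix (Fin n) (Fin n) K}

theorem mem_cubicImage_of_trace_eq_zero (hα : l1 + l2 + m3 ≠ 0)
    (hsum : l1 + l2 + l3 + m1 + m2 + m3 = 0) (hw : w.trace = 0) :
    w ∈ cubicImage (Fin n) l1 l2 l3 m1 m2 m3 := by
  have hcomm : ∀ b c : Matrix (Fin n) (Fin n) K,
      b * c - c * b ∈ cubicImage (Fin n) l1 l2 l3 m1 m2 m3 := fun b c => by
    refine ⟨(l1 + l2 + m3)⁻¹ • 1, b, c, ?_⟩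
    obtain rfl : m1 = -(l1 + l2 + m3) - l3 - m2 := by linear_combination hsum
    simp only [smul_mul_assoc, mul_smul_comm, one_mul, mul_one, smul_smul]
    match_scalars <;> field_simp
    ring
  by_cases hs : ∃ σ : K, w = Matrix.scalar (Fin n) σ
  · obtain ⟨σ, rfl⟩ := hs
    rcases Matrix.scalar_eq_zero_or_natCast_eq_zero hw with rfl | hn
    · simpa using hcomm 0 0
    · obtain ⟨x, y, hxy⟩ := Matrix.exists_commutator_eq_one hn
      have := smul_mem_cubicImage σ (hcomm x y)
      rwa [hxy, Matrix.smul_one_eq_diagonal] at this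
  · obtain ⟨P, Q, hQP, hd⟩ := w.exists_conj_diag_eq hs 0 (by simp [hw])
    obtain ⟨β, hβ, -⟩ := exists_injective_forall_notMem (n := n) (∅ : Finset K)
    obtain ⟨c, -, hc⟩ := Matrix.exists_commutator_diagonal_eq hβ hd
    exact mem_cubicImage_of_conj hQP (hc ▸ hcomm _ _)

theorem mem_cubicImage_of_trace_eq_zero_of_lie (h2 : (2 : K) ≠ 0) (hl2 : l2 ≠ 0)
    (hl : l1 + l2 + l3 = 0) (h1 : m1 = l1) (h2' : m2 = l2) (h3 : m3 = l3) (hw : w.trace = 0) :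
    w ∈ cubicImage (Fin n) l1 l2 l3 m1 m2 m3 := by
  subst h1 h2' h3
  obtain rfl : m1 = -m2 - m3 := by linear_combination hl
  have hcomm : ∀ b c : Matrix (Fin n) (Fin n) K,
      b * (b * c - c * b) - (b * c - c * b) * b ∈
        cubicImage (Fin n) (-m2 - m3) m2 m3 (-m2 - m3) m2 m3 := fun b c => by
    refine ⟨b, b, (-m2)⁻¹ • c, ?_⟩
    simp only [smul_mul_assoc, mul_smul_comm, smul_smul, mul_sub, sub_mul, ← mul_assoc]
    match_scalars <;> field_simp <;> ring
  by_cases hs : ∃ σ : K, w = Matrix.scalar (Fin n) σ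
  · obtain ⟨σ, rfl⟩ := hs
    rcases Matrix.scalar_eq_zero_or_natCast_eq_zero hw with rfl | hn
    · simpa using hcomm 0 0
    · obtain ⟨x, y, hxy⟩ := Matrix.exists_commutator_eq_one hn
      have hx : x * y = 1 + y * x := by rw [← hxy]; abel
      have hyy : x * (y * y) - y * y * x = (2 : K) • y := by
        rw [← mul_assoc, hx, add_mul, one_mul, mul_assoc y x y, hx, mul_add, mul_one, two_smul,
          mul_assoc]
        abel
      have h := smul_mem_cubicImage (σ * 2⁻¹) (hcomm x (y * y))
      rw [hyy, mul_smul_comm, smul_mul_assoc, ← smul_sub, hxy, smul_smul, mul_assoc,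
        inv_mul_cancel₀ h2, mul_one] at h
      rwa [Matrix.smul_one_eq_diagonal] at h
  · obtain ⟨P, Q, hQP, hd⟩ := w.exists_conj_diag_eq hs 0 (by simp [hw])
    obtain ⟨β, hβ, -⟩ := exists_injective_forall_notMem (n := n) (∅ : Finset K)
    obtain ⟨c, hc0, hc⟩ := Matrix.exists_commutator_diagonal_eq hβ hd
    obtain ⟨c', -, hc'⟩ := Matrix.exists_commutator_diagonal_eq hβ hc0
    refine mem_cubicImage_of_conj hQP ?_
    rw [← hc, ← hc']
    exact hcomm _ _

end Commutators

section NonzeroTrace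

variable {K : Type*} [Field K] {n : ℕ} {l1 l2 l3 m1 m2 m3 : K}

theorem cubic_diagonal_apply (d β : Fin n → K) (p q : Fin n) (c : Matrix (Fin n) (Fin n) K)
    (i j : Fin n) :
    (l1 • (Matrix.diagonal d * (Matrix.diagonal β + Matrix.single p q 1) * c)
      + l2 • ((Matrix.diagonal β + Matrix.single p q 1) * c * Matrix.diagonal d)
      + l3 • (c * Matrix.diagonal d * (Matrix.diagonal β + Matrix.single p q 1))
      + m1 • (c * (Matrix.diagonal β + Matrix.single p q 1) * Matrix.diagonal d)
      + m2 • (Matrix.diagonal d * c * (Matrix.diagonal β + Matrix.single p q 1))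
      + m3 • ((Matrix.diagonal β + Matrix.single p q 1) * Matrix.diagonal d * c) :
        Matrix (Fin n) (Fin n) K) i j
    = c i j * (β i * ((l1 + m3) * d i + l2 * d j) + β j * (m2 * d i + (m1 + l3) * d j))
      + (if i = p then c q j * (l1 * d p + l2 * d j + m3 * d q) else 0)
      + (if j = q then c i p * (m2 * d i + m1 * d q + l3 * d p) else 0) := by
  have hl : ∀ (M : Matrix (Fin n) (Fin n) K), (Matrix.single p q (1 : K) * M : Matrix (Fin n) (Fin n) K) i j
      = if i = p then M q j else 0 := fun M => by
    split_ifs with h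
    · subst h; simp
    · exact Matrix.single_mul_apply_of_ne _ _ _ _ _ h _
  have hr : ∀ (M : Matrix (Fin n) (Fin n) K), (M * Matrix.single p q (1 : K) : Matrix (Fin n) (Fin n) K) i j
      = if j = q then M i p else 0 := fun M => by
    split_ifs with h
    · subst h; simp
    · exact Matrix.mul_single_apply_of_ne _ _ _ _ _ h _
  simp only [mul_add, add_mul, mul_assoc, Matrix.add_apply, Matrix.smul_apply, smul_eq_mul]
  simp only [← mul_assoc (Matrix.single p q (1 : K)), ← mul_assoc c]
  simp only [mul_assoc (Matrix.single p q (1 : K)), Matrix.diagonal_mul, Matrix.mul_diagonal, hl, hr]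
  split_ifs <;> subst_vars <;> ring

theorem mem_cubicImage_of_not_scalar [Infinite K] (hn : 2 ≤ n) (hα : l1 + l2 + m3 ≠ 0)
    (hl : l1 + l2 + l3 ≠ 0) (hm : m1 + m2 + m3 = -(l1 + l2 + l3))
    {w : Matrix (Fin n) (Fin n) K} (hw : ¬ ∃ σ : K, w = Matrix.scalar (Fin n) σ)
    (htr : w.trace ≠ 0) : w ∈ cubicImage (Fin n) l1 l2 l3 m1 m2 m3 := by
  classical
  obtain ⟨p, q, hpq⟩ : ∃ p q : Fin n, p ≠ q :=
    ⟨⟨0, by omega⟩, ⟨1, by omega⟩, by simp⟩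
  obtain ⟨t, ht⟩ := Infinite.exists_notMem_finset ({0, m2, -l2, -l1} : Finset K)
  simp only [Finset.mem_insert, Finset.mem_singleton, not_or] at ht
  obtain ⟨ht0, ht1, ht2, ht3⟩ := ht
  obtain ⟨κ, hκ⟩ : ∃ κ, κ = w.trace / (l1 + l2 + l3) := ⟨_, rfl⟩
  have hκ0 : κ ≠ 0 := hκ ▸ div_ne_zero htr hl
  obtain ⟨α, hα'⟩ : ∃ α, α = l1 + l2 + m3 := ⟨_, rfl⟩
  rw [← hα'] at hα
  obtain rfl : m3 = α - l1 - l2 := by linear_combination -hα'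
  obtain rfl : l3 = -α - m1 - m2 := by linear_combination hm
  obtain ⟨P, Q, hQP, hd⟩ := w.exists_conj_diag_eq hw
    (fun i => if i = p then κ * (t + l1 + l2) else if i = q then κ * (-α - m1 - m2 - t) else 0) (by
      have : ∀ i : Fin n, (if i = p then κ * (t + l1 + l2) else
          if i = q then κ * (-α - m1 - m2 - t) else 0)
          = (if i = p then κ * (t + l1 + l2) else 0)
            + if i = q then κ * (-α - m1 - m2 - t) else 0 := by
        intro i
        split_ifs with h1 h2
        · exact absurd (h1.symm.trans h2) hpq
        all_goals simp
      simp only [this, Finset.sum_add_distrib, Finset.sum_ite_eq', Finset.mem_univ, if_true]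
      rw [hκ]
      field_simp
      ring)
  refine mem_cubicImage_of_conj hQP ?_
  generalize P * w * Q = v at hd
  obtain ⟨s, hs⟩ : ∃ s, s = t / α := ⟨_, rfl⟩
  have hst : α * s = t := by rw [hs]; field_simp
  obtain ⟨βq, hβq⟩ : ∃ βq, βq = v q p / (κ * (t + l2)) := ⟨_, rfl⟩
  have ht2' : t + l2 ≠ 0 := fun h => ht2 (by linear_combination h)
  have ht1' : m2 - t ≠ 0 := fun h => ht1 (by linear_combination -h)
  have ht3' : t + l1 ≠ 0 := fun h => ht3 (by linear_combination h)
  have hβq' : κ * (βq * (t + l2)) = v q p := by rw [hβq]; field_simp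
  obtain ⟨γ, hγ, hγS⟩ := exists_injective_forall_notMem (n := n) ({0, βq} : Finset K)
  simp only [Finset.mem_insert, Finset.mem_singleton, not_or] at hγS
  let d : Fin n → K := fun i => if i = p then s + 1 else s
  let β : Fin n → K := fun i => if i = p then 0 else if i = q then βq else γ i
  let M : Fin n → Fin n → K := fun i j =>
    β i * ((l1 + (α - l1 - l2)) * d i + l2 * d j) + β j * (m2 * d i + (m1 + (-α - m1 - m2)) * d j)
  have hdp : d p = s + 1 := if_pos rfl
  have hdn : ∀ i, i ≠ p → d i = s := fun i hi => if_neg hi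
  have hβp : β p = 0 := if_pos rfl
  have hβn : ∀ i j, i ≠ p → j ≠ p → i ≠ j → β i ≠ β j := by
    intro i j hi hj hij
    simp only [β, if_neg hi, if_neg hj]
    split_ifs with h1 h2 h2
    · exact absurd (h1.trans h2.symm) hij
    · exact fun h => (hγS j).2 h.symm
    · exact (hγS i).2
    · exact fun h => hij (hγ h)
  have hβ0 : ∀ i, i ≠ p → i ≠ q → β i ≠ 0 := by
    intro i hi hj
    simp only [β, if_neg hi, if_neg hj]
    exact (hγS i).1
  have hMdiag : ∀ i, M i i = 0 := fun i => by simp only [M]; ring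
  have hMp : ∀ j, j ≠ p → M p j = β j * (m2 - t) := fun j hj => by
    simp only [M, hβp, hdp, hdn j hj]; linear_combination (-β j) * hst
  have hMip : ∀ i, i ≠ p → M i p = β i * (t + l2) := fun i hi => by
    simp only [M, hβp, hdp, hdn i hi]; linear_combination (β i) * hst
  have hMn : ∀ i j, i ≠ p → j ≠ p → M i j = t * (β i - β j) := fun i j hi hj => by
    simp only [M, hdn i hi, hdn j hj]; linear_combination (β i - β j) * hst
  have hMp0 : ∀ j, j ≠ p → j ≠ q → M p j ≠ 0 := fun j hj hj' => by
    rw [hMp j hj]; exact mul_ne_zero (hβ0 j hj hj') ht1'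
  have hMip0 : ∀ i, i ≠ p → i ≠ q → M i p ≠ 0 := fun i hi hi' => by
    rw [hMip i hi]; exact mul_ne_zero (hβ0 i hi hi') ht2'
  have hMn0 : ∀ i j, i ≠ p → j ≠ p → i ≠ j → M i j ≠ 0 := fun i j hi hj hij => by
    rw [hMn i j hi hj]; exact mul_ne_zero ht0 (sub_ne_zero.2 (hβn i j hi hj hij))
  have hqp : q ≠ p := hpq.symm
  let c : Matrix (Fin n) (Fin n) K := Matrix.of fun i j =>
    if i = j then (if i = q then v p q / (t + l1) else 0)
    else if i = q ∧ j = p then κ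
    else if i = p ∧ j = q then 0
    else if i = p then
      (v p j - v q j / M q j * (l1 * d p + l2 * d j + (α - l1 - l2) * d q)) / M p j
    else if j = q then
      (v i q - v i p / M i p * (m2 * d i + m1 * d q + (-α - m1 - m2) * d p)) / M i q
    else v i j / M i j
  refine ⟨Matrix.diagonal d, Matrix.diagonal β + Matrix.single p q 1, c, ?_⟩
  ext i j
  rw [cubic_diagonal_apply]
  change v i j = c i j * M i j + _ + _
  have hcdiag : ∀ i, i ≠ q → c i i = 0 := fun i hi => by simp [c, hi]
  have hcqq : c q q = v p q / (t + l1) := by simp [c]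
  have hcqp : c q p = κ := by simp [c, hqp]
  have hcpq : c p q = 0 := by simp [c, hpq]
  have hcgen : ∀ i j, i ≠ j → i ≠ p → j ≠ q → ¬ (i = q ∧ j = p) → c i j = v i j / M i j :=
    fun i j hij hi hj h => by simp only [c, Matrix.of_apply, if_neg hij, if_neg h,
      if_neg hi, if_neg hj, if_neg (fun h' : i = p ∧ j = q => hi h'.1)]
  have hcpj : ∀ j, j ≠ p → j ≠ q → c p j =
      (v p j - v q j / M q j * (l1 * d p + l2 * d j + (α - l1 - l2) * d q)) / M p j :=
    fun j hj hj' => by simp [c, hj, hj', hj.symm, hpq]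
  have hciq : ∀ i, i ≠ p → i ≠ q → c i q =
      (v i q - v i p / M i p * (m2 * d i + m1 * d q + (-α - m1 - m2) * d p)) / M i q :=
    fun i hi hi' => by simp [c, hi, hi', hqp]
  have hdq : d q = s := hdn q hqp
  by_cases hip : i = p
  · subst hip
    rw [if_pos rfl]
    by_cases hjp : j = i
    · subst hjp
      rw [if_neg hpq, hMdiag, hcqp, hd, if_pos rfl, hdp, hdq]
      linear_combination (-κ) * hst
    by_cases hjq : j = q
    · subst hjq
      rw [if_pos rfl, hcpq, hcqq, hcdiag i hpq, hdp, hdq]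
      field_simp
      linear_combination (-v i j) * hst
    · rw [if_neg hjq, hcpj j hjp hjq, hcgen q j (Ne.symm hjq) hqp hjq (fun h => hjp h.2)]
      have := hMp0 j hjp hjq
      rw [div_mul_cancel₀ _ this]
      ring
  rw [if_neg hip]
  by_cases hiq : i = q
  · subst hiq
    by_cases hjq : j = i
    · subst hjq
      rw [if_pos rfl, hMdiag, hcqp, hd, if_neg hip, if_pos rfl, hdp, hdq]
      linear_combination κ * hst
    rw [if_neg hjq]
    by_cases hjp : j = p
    · subst hjp
      have hβi : β i = βq := by simp [β, hip]
      rw [hcqp, hMip i hip, hβi, hβq']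
      ring
    · rw [hcgen i j (Ne.symm hjq) hip hjq (fun h => hjp h.2),
        div_mul_cancel₀ _ (hMn0 i j hip hjp (Ne.symm hjq))]
      ring
  by_cases hjq : j = q
  · subst hjq
    rw [if_pos rfl, hciq i hip hiq, hcgen i p hip hip hpq (fun h => hiq h.1),
      div_mul_cancel₀ _ (hMn0 i j hip hqp hiq)]
    ring
  rw [if_neg hjq]
  by_cases hij : i = j
  · subst hij
    rw [hcdiag i hiq, hd, if_neg hip, if_neg hiq]
    ring
  have hM0 : M i j ≠ 0 := by
    by_cases hjp : j = p
    · subst hjp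
      exact hMip0 i hip hiq
    · exact hMn0 i j hip hjp hij
  rw [hcgen i j hij hip hjq (fun h => hiq h.1), div_mul_cancel₀ _ hM0]
  ring

end NonzeroTrace

section Dichotomy

variable {K : Type*} [Field K] {n : ℕ} {l1 l2 l3 m1 m2 m3 : K}

theorem cubicImage_eq_univ_of_sum_ne_zero (hsum : l1 + l2 + l3 + m1 + m2 + m3 ≠ 0) :
    cubicImage (Fin n) l1 l2 l3 m1 m2 m3 = Set.univ := by
  refine Set.eq_univ_of_forall fun w => ⟨(l1 + l2 + l3 + m1 + m2 + m3)⁻¹ • w, 1, 1, ?_⟩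
  simp only [mul_one, one_mul, ← add_smul, smul_smul]
  rw [← add_mul, ← add_mul, ← add_mul, ← add_mul, ← add_mul, mul_inv_cancel₀ hsum, one_smul]

variable [Infinite K]

theorem cubicImage_eq_sl_or_univ_of_ne_zero (hn : 2 ≤ n) (hα : l1 + l2 + m3 ≠ 0)
    (hsum : l1 + l2 + l3 + m1 + m2 + m3 = 0) :
    cubicImage (Fin n) l1 l2 l3 m1 m2 m3 = {w | w.trace = 0} ∨
      cubicImage (Fin n) l1 l2 l3 m1 m2 m3 = Set.univ := by
  have hm : m1 + m2 + m3 = -(l1 + l2 + l3) := by linear_combination hsum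
  by_cases hl : l1 + l2 + l3 = 0
  · left
    ext w
    exact ⟨trace_of_mem_cubicImage hl (by rw [hm, hl, neg_zero]),
      mem_cubicImage_of_trace_eq_zero hα hsum⟩
  · right
    refine Set.eq_univ_of_forall fun w => ?_
    by_cases htr : w.trace = 0
    · exact mem_cubicImage_of_trace_eq_zero hα hsum htr
    by_cases hw : ∃ σ : K, w = Matrix.scalar (Fin n) σ
    · obtain ⟨σ, rfl⟩ := hw
      obtain ⟨k, rfl⟩ := Nat.exists_eq_add_of_le' hn
      rw [Matrix.scalar_apply, ← Matrix.smul_one_eq_diagonal]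
      exact smul_mem_cubicImage σ (one_mem_cubicImage hα hl hm k)
    · exact mem_cubicImage_of_not_scalar hn hα hl hm hw htr

theorem cubicImage_eq_sl_of_lie (h2 : (2 : K) ≠ 0) (hl2 : l2 ≠ 0) (hl : l1 + l2 + l3 = 0) :
    cubicImage (Fin n) l1 l2 l3 l1 l2 l3 = {w | w.trace = 0} := by
  ext w
  exact ⟨trace_of_mem_cubicImage hl hl,
    mem_cubicImage_of_trace_eq_zero_of_lie h2 hl2 hl rfl rfl rfl⟩

theorem cubicImage_eq_sl_or_univ (hn : 2 ≤ n) (h2 : (2 : K) ≠ 0)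
    (hne : ¬ (l1 = 0 ∧ l2 = 0 ∧ l3 = 0 ∧ m1 = 0 ∧ m2 = 0 ∧ m3 = 0)) :
    cubicImage (Fin n) l1 l2 l3 m1 m2 m3 = {w | w.trace = 0} ∨
      cubicImage (Fin n) l1 l2 l3 m1 m2 m3 = Set.univ := by
  by_cases hsum : l1 + l2 + l3 + m1 + m2 + m3 = 0
  swap
  · exact Or.inr (cubicImage_eq_univ_of_sum_ne_zero hsum)
  by_cases hα1 : l1 + l2 + m3 = 0
  swap
  · exact cubicImage_eq_sl_or_univ_of_ne_zero hn hα1 hsum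
  by_cases hα2 : l2 + l3 + m1 = 0
  swap
  · rw [← cubicImage_rotate]
    exact cubicImage_eq_sl_or_univ_of_ne_zero hn hα2 (by linear_combination hsum)
  by_cases hα3 : l3 + l1 + m2 = 0
  swap
  · rw [← cubicImage_rotate, ← cubicImage_rotate]
    exact cubicImage_eq_sl_or_univ_of_ne_zero hn hα3 (by linear_combination hsum)
  have hl : l1 + l2 + l3 = 0 := by linear_combination hα1 + hα2 + hα3 - hsum
  obtain rfl : m1 = l1 := by linear_combination hα2 - hl
  obtain rfl : m2 = l2 := by linear_combination hα3 - hl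
  obtain rfl : m3 = l3 := by linear_combination hα1 - hl
  left
  by_cases hl2 : m2 = 0
  · by_cases hl3 : m3 = 0
    · exact absurd ⟨by linear_combination hl - hl2 - hl3, hl2, hl3,
        by linear_combination hl - hl2 - hl3, hl2, hl3⟩ hne
    · rw [← cubicImage_rotate]
      exact cubicImage_eq_sl_of_lie h2 hl3 (by linear_combination hl)
  · exact cubicImage_eq_sl_of_lie h2 hl2 hl

end Dichotomy

/-- Main theorem (Theorem 3.2): for `n ≥ 4` and a field `F` of characteristic
not 2 or 3 satisfying the root-of-unity condition, the image of a nonzero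
multilinear polynomial of degree three in `Mₙ(K)` (for `K` an algebraically
closed extension of `F`) is either `slₙ(K)` or `Mₙ(K)`. -/
theorem image_eq_sl_or_full
    (n : ℕ) (hn : 4 ≤ n) (F : Type*) [Field F]
    (hchar2 : ringChar F ≠ 2) (hchar3 : ringChar F ≠ 3)
    (hroots : ∀ ω η θ : F, ω ^ n = 1 → η ^ n = 1 → θ ^ n = 1 →
      ω ≠ 1 → η ≠ 1 → θ ≠ 1 → ω * η * θ - ω - η - θ + 2 ≠ 0)
    (l1 l2 l3 m1 m2 m3 : F)
    (hne : ¬ (l1 = 0 ∧ l2 = 0 ∧ l3 = 0 ∧ m1 = 0 ∧ m2 = 0 ∧ m3 = 0))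
    (K : Type*) [Field K] [IsAlgClosed K] (φ : F →+* K) :
    {w : Matrix (Fin n) (Fin n) K | ∃ a b c : Matrix (Fin n) (Fin n) K,
        w = φ l1 • (a * b * c) + φ l2 • (b * c * a) + φ l3 • (c * a * b)
          + φ m1 • (c * b * a) + φ m2 • (a * c * b) + φ m3 • (b * a * c)}
      = {w : Matrix (Fin n) (Fin n) K | Matrix.trace w = 0} ∨
    {w : Matrix (Fin n) (Fin n) K | ∃ a b c : Matrix (Fin n) (Fin n) K,
        w = φ l1 • (a * b * c) + φ l2 • (b * c * a) + φ l3 • (c * a * b)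
          + φ m1 • (c * b * a) + φ m2 • (a * c * b) + φ m3 • (b * a * c)}
      = Set.univ := by
  have h2 : (2 : K) ≠ 0 := by
    rw [← map_ofNat φ 2]
    exact (map_ne_zero φ).2 (Ring.two_ne_zero hchar2)
  have : Infinite K := IsAlgClosed.instInfinite
  exact cubicImage_eq_sl_or_univ (by omega) h2 (by simpa only [map_eq_zero] using hne)
end

section
/- Let n ≥ 3 be a natural number, let K be an infinite field, and let A be a unital associative K-algebra (with at least one element, nontrivial). If λ ∈ K and λ ≠ 1, then the polynomial f(x,y,z) = x(yz − zy) − λ(yz − zy)x is surjective in Mₙ(A): for every matrix b ∈ Mₙ(A) there exist x, y, z ∈ Mₙ(A) with x·(y·z − z·y) − λ·((y·z − z·y)·x) = b. -/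
open Equiv

/-- The commutator of a permutation matrix with a suitable monomial matrix is the diagonal matrix
of differences along the permutation. -/
lemma permMatrix_commutator {ι R : Type*} [Fintype ι] [DecidableEq ι] [Ring R]
    (σ : Perm ι) (t : ι → R) :
    σ.permMatrix R * (Matrix.diagonal t * σ⁻¹.permMatrix R) -
      Matrix.diagonal t * σ⁻¹.permMatrix R * σ.permMatrix R =
      Matrix.diagonal fun i ↦ t (σ i) - t i := by
  have hinv : σ⁻¹.permMatrix R * σ.permMatrix R = 1 := by
    rw [← Matrix.permMatrix_mul, mul_inv_cancel, Matrix.permMatrix_one]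
  rw [Matrix.mul_assoc, hinv, Matrix.mul_one, PEquiv.toMatrix_toPEquiv_mul,
    PEquiv.mul_toMatrix_toPEquiv, ← Matrix.diagonal_sub]
  congr 1
  ext i j
  by_cases h : i = j <;> simp [h, Perm.inv_def]

/-- A generic vector has differences along `σ` avoiding all the relations `u = l * v`. -/
lemma exists_forall_perm_sub_sub_mul_ne_zero {ι K : Type*} [Finite ι] [Field K] [Infinite K]
    (σ : Perm ι) (h₁ : ∀ i, σ i ≠ i) (h₂ : ∀ i, σ (σ i) ≠ i) {l : K} (hl : l ≠ 1) :
    ∃ s : ι → K, ∀ i j, (s (σ j) - s j) - l * (s (σ i) - s i) ≠ 0 := by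
  classical
  let d (i : ι) : Module.Dual K (ι → K) :=
    LinearMap.proj (R := K) (φ := fun _ ↦ K) (σ i) - LinearMap.proj i
  obtain ⟨s, hs⟩ := Module.Dual.exists_forall_ne_zero_of_forall_exists
    (fun p : ι × ι ↦ d p.2 - l • d p.1) (by
      rintro ⟨i, j⟩
      obtain rfl | hij := eq_or_ne i j
      · exact ⟨Pi.single (σ i) 1, by simpa [d, (h₁ i).symm, sub_eq_zero] using hl.symm⟩
      obtain rfl | hji := eq_or_ne j (σ i)
      · exact ⟨Pi.single (σ (σ i)) 1, by simp [d, (h₁ (σ i)).symm, (h₂ i).symm]⟩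
      · exact ⟨Pi.single j 1, by simp [d, hij, h₁ j, hji.symm]⟩)
  exact ⟨s, fun i j ↦ by simpa [d] using hs (i, j)⟩

/-- If no `c j` equals `l * c i`, then `x ↦ x * c - l • (c * x)` is surjective for the scalar
diagonal matrix `c`. -/
lemma exists_mul_diagonal_sub_smul_diagonal_mul {ι K A : Type*} [Fintype ι] [DecidableEq ι]
    [Field K] [Ring A] [Algebra K A] {l : K} {c : ι → K} (hc : ∀ i j, c j - l * c i ≠ 0)
    (b : Matrix ι ι A) :
    ∃ x : Matrix ι ι A, x * Matrix.diagonal (fun i ↦ algebraMap K A (c i)) -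
      l • (Matrix.diagonal (fun i ↦ algebraMap K A (c i)) * x) = b := by
  refine ⟨Matrix.of fun i j ↦ (c j - l * c i)⁻¹ • b i j, ?_⟩
  ext i j
  simp only [Matrix.sub_apply, Matrix.smul_apply, Matrix.mul_diagonal, Matrix.diagonal_mul,
    Matrix.of_apply, ← Algebra.commutes, ← Algebra.smul_def, smul_smul, ← sub_smul]
  rw [← mul_assoc, ← sub_mul, mul_inv_cancel₀ (hc i j), one_smul]

/-- Lemma 3.1: for `n ≥ 3`, an infinite field `K`, a nontrivial unital
associative `K`-algebra `A`, and `λ ≠ 1` in `K`, the polynomial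
`f(x,y,z) = x[y,z] − λ[y,z]x` is surjective in `Mₙ(A)`. -/
theorem x_comm_sub_smul_comm_x_surjective
    (n : ℕ) (hn : 3 ≤ n) (K : Type*) [Field K] [Infinite K]
    (A : Type*) [Ring A] [Algebra K A] [Nontrivial A]
    (l : K) (hl : l ≠ 1) :
    ∀ b : Matrix (Fin n) (Fin n) A, ∃ x y z : Matrix (Fin n) (Fin n) A,
      x * (y * z - z * y) - l • ((y * z - z * y) * x) = b := by
  intro b
  have hσ : ∀ i : Fin n, finRotate n i ≠ i ∧ finRotate n (finRotate n i) ≠ i := by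
    obtain ⟨m, rfl⟩ : ∃ m, n = m + 3 := ⟨n - 3, by omega⟩
    refine fun i ↦ ⟨?_, ?_⟩
    · simp
    · simpa [add_assoc, Fin.ext_iff, Fin.val_add] using
        (Nat.mod_eq_of_lt (show 2 < m + 3 by omega)).trans_ne two_ne_zero
  obtain ⟨s, hs⟩ := exists_forall_perm_sub_sub_mul_ne_zero (finRotate n)
    (fun i ↦ (hσ i).1) (fun i ↦ (hσ i).2) hl
  obtain ⟨x, hx⟩ := exists_mul_diagonal_sub_smul_diagonal_mul
    (c := fun i ↦ s (finRotate n i) - s i) hs b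
  refine ⟨x, (finRotate n).permMatrix A,
    Matrix.diagonal (fun i ↦ algebraMap K A (s i)) * (finRotate n)⁻¹.permMatrix A, ?_⟩
  simpa only [permMatrix_commutator, map_sub] using hx
end

section
/- Let n ≥ 1 be a natural number, let F be any field, and let K be an infinite field extending F (via a ring homomorphism F → K). Index vectors by ℤ/nℤ and let s denote the cyclic shift (s w)_i = w_{i−1} on n-tuples. Let u, v ∈ Fⁿ and assume the vectors u, s u, …, s^{n−1} u are linearly independent over F. For x₀, …, x_{n−1} ∈ K define the matrix a(x₀,…,x_{n−1}) ∈ Mₙ(K) whose (i,j)-entry is x_j u_{i−j} + x_{j+1} v_{i−j} (indices taken mod n, and u, v mapped into K), i.e. its j-th column is s^j(x_j u + x_{j+1} v). If there is NO tuple (x₀,…,x_{n−1}) with all x_i ≠ 0 for which a(x₀,…,x_{n−1}) is invertible, then there exist i ∈ ℤ/nℤ with i invertible in ℤ/nℤ (i.e. i coprime to n) and ω ∈ F with ωⁿ = 1 such that v = −ω · sⁱ u. -/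
/-- A function on `ZMod n` with zero total sum is a discrete derivative along the cycle. -/
theorem ZMod.exists_cyclic_primitive (n : ℕ) [NeZero n] (g : ZMod n → ℤ) (hg : ∑ j, g j = 0) :
    ∃ h : ZMod n → ℤ, ∀ j, h (j + 1) = h j + g j := by
  have hn : ∑ i ∈ Finset.range n, g (i : ZMod n) = 0 := by
    rw [← hg]
    refine Finset.sum_bij' (fun i _ => (i : ZMod n)) (fun j _ => j.val) ?_ ?_ ?_ ?_ ?_
    · simp
    · intro j _
      simpa using ZMod.val_lt j
    · intro i hi
      exact ZMod.val_cast_of_lt (Finset.mem_range.mp hi)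
    · intro j _
      simp
    · simp
  have hper : Function.Periodic (fun k => ∑ i ∈ Finset.range k, g (i : ZMod n)) n := by
    intro k
    simp only
    rw [add_comm k n, Finset.sum_range_add, hn, zero_add]
    simp
  refine ⟨fun j => ∑ i ∈ Finset.range j.val, g (i : ZMod n), fun j => ?_⟩
  have hj : (j + 1).val = (j.val + 1) % n := by
    rw [← ZMod.val_natCast]
    simp
  have := hper.map_mod_nat (j.val + 1)
  simp only at this ⊢
  rw [hj, this, Finset.sum_range_succ]
  simp

/-- If `diag(x) + W diag(s⁻¹ x)` is singular for all `x` with nonzero entries, where `W` is the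
circulant matrix of `w`, then every proper principal submatrix of `W` is singular. -/
theorem exists_vecMul_principal_submatrix_eq_zero {n : ℕ} [NeZero n] {K : Type*} [Field K]
    [Infinite K] {w : ZMod n → K}
    (hw : ∀ x : ZMod n → K, (∀ i, x i ≠ 0) →
      (Matrix.of fun i j : ZMod n =>
        x j * (if i = j then 1 else 0) + x (j + 1) * w (i - j)).det = 0)
    (S : Finset (ZMod n)) (hS : S.Nonempty) (hSn : S.card < n) :
    ∃ y : ZMod n → K, y ≠ 0 ∧ (∀ j ∉ S, y j = 0) ∧
      ∀ j ∈ S, ∑ i ∈ S, y i * w (i - j) = 0 := by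
  have hcard : 0 < S.card := hS.card_pos
  obtain ⟨h, hh⟩ := ZMod.exists_cyclic_primitive n
    (fun j => if j ∈ S then -((n : ℤ) - S.card) else S.card) (by
      rw [Finset.sum_ite]
      have h1 : (Finset.univ.filter fun j => j ∉ S).card = n - S.card := by
        rw [← Finset.compl_filter, Finset.card_compl]
        simp
      simp only [Finset.sum_const, h1, Finset.filter_mem_eq_inter, Finset.univ_inter, nsmul_eq_mul]
      push_cast [hSn.le]
      ring)
  let N : Matrix (ZMod n) (ZMod n) (Polynomial K) := Matrix.of fun i j =>
    if j ∈ S then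
      Polynomial.X ^ (n - S.card) * (if i = j then 1 else 0) + Polynomial.C (w (i - j))
    else (if i = j then 1 else 0) + Polynomial.X ^ S.card * Polynomial.C (w (i - j))
  have heval : ∀ t : K, N.det.eval t = (Matrix.of fun i j : ZMod n =>
      if j ∈ S then t ^ (n - S.card) * (if i = j then 1 else 0) + w (i - j)
      else (if i = j then 1 else 0) + t ^ S.card * w (i - j)).det := by
    intro t
    rw [← Polynomial.coe_evalRingHom, RingHom.map_det]
    congr 1
    ext i j
    simp only [N, RingHom.mapMatrix_apply, Matrix.map_apply, Matrix.of_apply]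
    split_ifs <;> simp <;> ring
  have hzero : ∀ t : K, t ≠ 0 → N.det.eval t = 0 := by
    intro t ht
    have hx := hw (fun j => t ^ h j) (fun i => zpow_ne_zero _ ht)
    have hfac : (Matrix.of fun i j : ZMod n =>
        t ^ h j * (if i = j then 1 else 0) + t ^ h (j + 1) * w (i - j)) =
        Matrix.of fun i j => (fun j => if j ∈ S then t ^ h (j + 1) else t ^ h j) j *
          (Matrix.of fun i j : ZMod n =>
            if j ∈ S then t ^ (n - S.card) * (if i = j then 1 else 0) + w (i - j)
            else (if i = j then 1 else 0) + t ^ S.card * w (i - j)) i j := by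
      ext i j
      simp only [Matrix.of_apply]
      by_cases hj : j ∈ S
      · have e : t ^ h j = t ^ h (j + 1) * t ^ (n - S.card) := by
          rw [← zpow_natCast, ← zpow_add₀ ht, hh j]
          congr 1
          push_cast [hSn.le]
          simp only [hj, if_true]
          ring
        simp only [hj, if_true]
        rw [e]
        ring
      · have e : t ^ h (j + 1) = t ^ h j * t ^ S.card := by
          rw [← zpow_natCast, ← zpow_add₀ ht, hh j]
          simp [hj]
        simp only [hj, if_false]
        rw [e]
        ring
    rw [hfac, Matrix.det_mul_row] at hx
    rw [heval]
    refine (mul_eq_zero.mp hx).resolve_left (Finset.prod_ne_zero_iff.mpr fun j _ => ?_)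
    split_ifs <;> exact zpow_ne_zero _ ht
  have hN : N.det = 0 := by
    apply Polynomial.eq_zero_of_infinite_isRoot
    exact (Set.finite_singleton (0 : K)).infinite_compl.mono fun t ht => hzero t ht
  have h0 := heval 0
  rw [hN, Polynomial.eval_zero] at h0
  obtain ⟨y, hy, hyN⟩ := Matrix.exists_vecMul_eq_zero_iff.mpr h0.symm
  have hout : ∀ j ∉ S, y j = 0 := by
    intro j hj
    have := congrFun hyN j
    simpa [Matrix.vecMul, dotProduct, hj, hcard.ne'] using this
  refine ⟨y, hy, hout, fun j hj => ?_⟩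
  have := congrFun hyN j
  have hne : n - S.card ≠ 0 := by omega
  simp only [Matrix.vecMul, dotProduct, hj, Matrix.of_apply, if_true, zero_pow hne, zero_mul,
    zero_add, Pi.zero_apply] at this
  rw [← this]
  exact Finset.sum_subset (Finset.subset_univ _) fun i _ hi => by simp [hout i hi]

/-- If all proper principal submatrices of the circulant matrix of `w` are singular and `w a ≠ 0`,
then `w` vanishes at the multiples `-(m • a)` that close up a cycle of length less than `n`. -/
theorem circulant_apply_neg_nsmul_eq_zero {n : ℕ} {K : Type*} [Field K]
    {w : ZMod n → K}
    (hw : ∀ S : Finset (ZMod n), S.Nonempty → S.card < n →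
      ∃ y : ZMod n → K, y ≠ 0 ∧ (∀ j ∉ S, y j = 0) ∧
        ∀ j ∈ S, ∑ i ∈ S, y i * w (i - j) = 0)
    {a : ZMod n} (ha : w a ≠ 0) (m : ℕ) (hm : m < addOrderOf a) (hmn : m + 1 < n) :
    w (-(m • a)) = 0 := by
  induction m using Nat.strong_induction_on with
  | _ m ih =>
  by_contra hne
  have hinj : Set.InjOn (fun q : ℕ => q • a) (Finset.range (m + 1)) := by
    intro p hp q hq hpq
    simp only [Finset.coe_range, Set.mem_Iio] at hp hq
    exact nsmul_injOn_Iio_addOrderOf (Set.mem_Iio.mpr (by omega)) (Set.mem_Iio.mpr (by omega)) hpq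
  obtain ⟨y, hy, hout, hsum⟩ := hw ((Finset.range (m + 1)).image fun q : ℕ => q • a)
    (by simp) (by rw [Finset.card_image_of_injOn hinj]; simpa using hmn)
  have hrow : ∀ p ≤ m, ∑ q ∈ Finset.range (m + 1), y (q • a) * w (q • a - p • a) = 0 := by
    intro p hp
    rw [← hsum (p • a) (Finset.mem_image_of_mem _ (Finset.mem_range.mpr (by omega))),
      Finset.sum_image hinj]
  have hlow : ∀ p q : ℕ, q ≤ p → p - q < m → w (q • a - p • a) = 0 := by
    intro p q hqp hlt
    rw [← ih (p - q) hlt (by omega) (by omega), sub_nsmul a hqp]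
    congr 1
    abel
  have hy0 : y 0 = 0 := by
    have := hrow m le_rfl
    rw [Finset.sum_eq_single 0] at this
    · rw [zero_nsmul, zero_sub] at this
      exact (mul_eq_zero.mp this).resolve_right hne
    · intro q hq hq0
      rw [hlow m q (by simp at hq; omega) (by simp at hq; omega), mul_zero]
    · simp
  have hyl : ∀ l < m, y ((m - l) • a) = 0 := by
    intro l
    induction l using Nat.strong_induction_on with
    | _ l ihl =>
    intro hl
    have := hrow (m - l - 1) (by omega)
    rw [Finset.sum_eq_single (m - l)] at this
    · have e : (m - l) • a - (m - l - 1) • a = a := by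
        obtain ⟨r, hr⟩ : ∃ r, m - l = r + 1 := ⟨m - l - 1, by omega⟩
        rw [hr, Nat.add_sub_cancel, succ_nsmul]
        abel
      rw [e] at this
      exact (mul_eq_zero.mp this).resolve_right ha
    · intro q hq hql
      rw [Finset.mem_range] at hq
      rcases lt_or_gt_of_ne hql with h | h
      · rw [hlow (m - l - 1) q (by omega) (by omega), mul_zero]
      · have := ihl (m - q) (by omega) (by omega)
        rw [show m - (m - q) = q by omega] at this
        rw [this, zero_mul]
    · intro h
      exact absurd (Finset.mem_range.mpr (by omega)) h
  apply hy
  funext j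
  by_cases hj : j ∈ (Finset.range (m + 1)).image fun q : ℕ => q • a
  · obtain ⟨q, hq, rfl⟩ := Finset.mem_image.mp hj
    rw [Finset.mem_range] at hq
    rcases Nat.eq_zero_or_pos q with rfl | hq0
    · simpa using hy0
    · have := hyl (m - q) (by omega)
      rwa [show m - (m - q) = q by omega] at this
  · exact hout j hj

/-- The case `u = e₀`: if `diag(x) + W diag(s⁻¹ x)` is singular for all `x` with nonzero entries,
where `W` is the circulant matrix of `w`, then `w` is supported at a single unit `a`, and
`-w a` is an `n`-th root of unity. -/
theorem exists_isUnit_support_of_forall_det_eq_zero {n : ℕ} [NeZero n] {K : Type*} [Field K]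
    [Infinite K] {w : ZMod n → K}
    (hw : ∀ x : ZMod n → K, (∀ i, x i ≠ 0) →
      (Matrix.of fun i j : ZMod n =>
        x j * (if i = j then 1 else 0) + x (j + 1) * w (i - j)).det = 0) :
    ∃ a : ZMod n, IsUnit a ∧ (-w a) ^ n = 1 ∧ ∀ b ≠ a, w b = 0 := by
  obtain ⟨y, hy, hyW⟩ := Matrix.exists_mulVec_eq_zero_iff.mpr (hw (fun _ => 1) (by simp))
  replace hyW : ∀ i, y i + ∑ j, w (i - j) * y j = 0 := by
    intro i
    have := congrFun hyW i
    simpa [Matrix.mulVec, dotProduct, add_mul, Finset.sum_add_distrib] using this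
  obtain ⟨i₀, hi₀⟩ := Function.ne_iff.mp hy
  obtain ⟨a, ha⟩ : ∃ a, w a ≠ 0 := by
    by_contra! h
    apply hi₀
    simpa [h] using hyW i₀
  have key := circulant_apply_neg_nsmul_eq_zero
    (exists_vecMul_principal_submatrix_eq_zero hw) ha
  have hpos : 0 < addOrderOf a := addOrderOf_pos a
  have hord : addOrderOf a = n := by
    have hle : addOrderOf a ≤ n := by
      simpa [ZMod.card] using addOrderOf_le_card_univ (x := a)
    by_contra hne
    apply ha
    rw [← key (addOrderOf a - 1) (by omega) (by omega)]
    congr 1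
    rw [sub_nsmul a hpos, addOrderOf_nsmul_eq_zero]
    simp
  have hmul : ∀ b : ZMod n, ∃ m < n, b = -(m • a) := by
    intro b
    have hinj : Function.Injective fun m : Fin n => -((m : ℕ) • a) := by
      intro p q hpq
      exact Fin.ext (nsmul_injOn_Iio_addOrderOf (Set.mem_Iio.mpr (p.2.trans_eq hord.symm))
        (Set.mem_Iio.mpr (q.2.trans_eq hord.symm)) (neg_injective hpq))
    obtain ⟨m, hm⟩ := ((Fintype.bijective_iff_injective_and_card _).mpr
      ⟨hinj, by simp [ZMod.card]⟩).2 b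
    exact ⟨m, m.2, hm.symm⟩
  have hsupp : ∀ b ≠ a, w b = 0 := by
    intro b hb
    obtain ⟨m, hm, rfl⟩ := hmul b
    refine key m (by omega) (lt_of_le_of_ne hm fun h => hb ?_)
    have h0 : (m + 1) • a = 0 := by
      rw [h.trans hord.symm, addOrderOf_nsmul_eq_zero]
    rw [succ_nsmul] at h0
    exact neg_eq_of_add_eq_zero_right h0
  refine ⟨a, ?_, ?_, hsupp⟩
  · obtain ⟨m, -, hm⟩ := hmul 1
    refine IsUnit.of_mul_eq_one (-(m : ZMod n)) ?_
    rw [hm, nsmul_eq_mul]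
    ring
  · have hstep : ∀ i, y i = -w a * y (i - a) := by
      intro i
      have := hyW i
      rw [Finset.sum_eq_single (i - a)] at this
      · rw [sub_sub_cancel] at this
        linear_combination this
      · intro j _ hj
        rw [hsupp _ fun h => hj (by rw [← h]; abel), zero_mul]
      · simp
    have hiter : ∀ k : ℕ, y i₀ = (-w a) ^ k * y (i₀ - k • a) := by
      intro k
      induction k with
      | zero => simp
      | succ k ih =>
        rw [ih, hstep (i₀ - k • a), succ_nsmul, ← sub_sub]
        ring
    have := hiter n
    rw [show n • a = 0 by simp, sub_zero] at this
    exact (mul_right_cancel₀ hi₀ (by rw [← this, one_mul])).symm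


/-- Lemma 2.1: if `u, s u, …, s^{n−1} u` are linearly independent and the matrix
`a(x₀,…,x_{n−1})` (with `(i,j)`-entry `x_j u_{i−j} + x_{j+1} v_{i−j}`) is not
invertible for any choice of nonzero `xᵢ ∈ K`, then `v = −ω sⁱ u` for some
`i ∈ (ℤ/nℤ)ˣ` and some `n`-th root of unity `ω ∈ F`. -/
theorem lemma_basic
    (n : ℕ) [NeZero n] (hn : 1 ≤ n) (F : Type*) [Field F]
    (K : Type*) [Field K] [Infinite K] (φ : F →+* K)
    (u v : ZMod n → F)
    (hind : LinearIndependent F (fun j : ZMod n => (fun i : ZMod n => u (i - j))))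
    (hS : ¬ ∃ x : ZMod n → K, (∀ i, x i ≠ 0) ∧
      IsUnit (Matrix.of fun i j : ZMod n =>
        x j * φ (u (i - j)) + x (j + 1) * φ (v (i - j)))) :
    ∃ i : ZMod n, IsUnit i ∧ ∃ ω : F, ω ^ n = 1 ∧
      ∀ j : ZMod n, v j = -(ω * u (j - i)) := by
  have hspan : v ∈ Submodule.span F
      (Set.range fun j : ZMod n => (fun i : ZMod n => u (i - j))) := by
    rw [hind.span_eq_top_of_card_eq_finrank (by simp)]
    trivial
  obtain ⟨w, hw⟩ := (Submodule.mem_span_range_iff_exists_fun F).mp hspan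
  have hv : ∀ k, v k = ∑ j, w j * u (k - j) := by
    intro k
    simp [← hw]
  have hdet : ∀ x : ZMod n → K, (∀ i, x i ≠ 0) →
      (Matrix.of fun i j : ZMod n =>
        x j * (if i = j then 1 else 0) + x (j + 1) * φ (w (i - j))).det = 0 := by
    intro x hx
    by_contra hne
    apply hS
    refine ⟨x, hx, ?_⟩
    have hU : IsUnit (Matrix.of fun i j : ZMod n => u (i - j)) :=
      Matrix.linearIndependent_cols_iff_isUnit.mp hind
    have hUK : IsUnit (Matrix.of fun i j : ZMod n => φ (u (i - j))) := hU.map φ.mapMatrix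
    convert hUK.mul ((Matrix.isUnit_iff_isUnit_det _).mpr (isUnit_iff_ne_zero.mpr hne)) using 1
    ext i j
    simp only [Matrix.of_apply, Matrix.mul_apply, mul_add, Finset.sum_add_distrib]
    congr 1
    · simp [mul_comm]
    · rw [hv, map_sum, Finset.mul_sum, ← Equiv.sum_comp (Equiv.subRight j)]
      refine Finset.sum_congr rfl fun k _ => ?_
      rw [Equiv.subRight_apply, sub_sub_sub_cancel_right, map_mul]
      ring
  obtain ⟨a, ha, hroot, hsupp⟩ := exists_isUnit_support_of_forall_det_eq_zero
    (w := fun i => φ (w i)) hdet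
  refine ⟨a, ha, -w a, φ.injective (by simpa using hroot), fun j => ?_⟩
  rw [hv, Finset.sum_eq_single a]
  · ring
  · intro b _ hb
    rw [(map_eq_zero φ).mp (hsupp b hb), zero_mul]
  · simp
end

section
/- Let n ≥ 2 be a natural number and F a field. Index vectors by ℤ/nℤ and let s denote the cyclic shift (s w)_i = w_{i−1}. Let u ∈ Fⁿ be the vector with u₀ = u₁ arbitrary prescribed values u₀ = a, u₁ = b, and u_i = 0 for i ≠ 0, 1. If the vectors u, s u, …, s^{n−1} u are linearly dependent over F, then there exists ω ∈ F with ωⁿ = 1 such that a + ω·b = 0. -/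
/-- Lemma 2.2: let `u ∈ Fⁿ` have coordinates `a, b` at indices `0, 1` and `0`
elsewhere. If `u, s u, …, s^{n−1} u` are linearly dependent, then there exists
an `n`-th root of unity `ω ∈ F` with `a + ω b = 0`. -/
theorem lemma_circulant
    (n : ℕ) [NeZero n] (hn : 2 ≤ n) (F : Type*) [Field F] (a b : F)
    (u : ZMod n → F) (hu0 : u 0 = a) (hu1 : u 1 = b)
    (hu : ∀ i : ZMod n, i ≠ 0 → i ≠ 1 → u i = 0)
    (hdep : ¬ LinearIndependent F
      (fun j : ZMod n => (fun i : ZMod n => u (i - j)))) :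
    ∃ ω : F, ω ^ n = 1 ∧ a + ω * b = 0 := by
  have : Fact (1 < n) := ⟨hn⟩
  obtain ⟨c, hc, k, hk⟩ := Fintype.not_linearIndependent_iff.mp hdep
  have hrec : ∀ i : ZMod n, a * c i + b * c (i - 1) = 0 := by
    intro i
    have h := congrFun hc i
    simp only [Finset.sum_apply, Pi.smul_apply, smul_eq_mul, Pi.zero_apply] at h
    have hne : i ≠ i - 1 := fun h' => one_ne_zero (sub_eq_self.mp h'.symm)
    rw [Fintype.sum_eq_add i (i - 1) hne] at h
    · rw [sub_self, sub_sub_cancel, hu0, hu1] at h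
      linear_combination h
    · rintro j ⟨hj₀, hj₁⟩
      rw [hu (i - j) (fun h' => hj₀ (sub_eq_zero.mp h').symm)
        (fun h' => hj₁ (by rw [← h', sub_sub_cancel])), mul_zero]
  by_cases hb : b = 0
  · refine ⟨1, one_pow n, ?_⟩
    have h := hrec k
    rw [hb, zero_mul, add_zero] at h
    rw [(mul_eq_zero.mp h).resolve_right hk, hb, mul_zero, add_zero]
  · have hstep : ∀ i, c (i - 1) = -(a / b) * c i := by
      intro i
      field_simp
      linear_combination hrec i
    have hpow : ∀ m : ℕ, c (k - m) = (-(a / b)) ^ m * c k := by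
      intro m
      induction m with
      | zero => simp
      | succ m ih => rw [Nat.cast_succ, ← sub_sub, hstep, ih, pow_succ', mul_assoc]
    refine ⟨-(a / b), ?_, by field_simp; ring⟩
    have h := hpow n
    rw [ZMod.natCast_self, sub_zero] at h
    exact mul_right_cancel₀ hk (by rw [one_mul, ← h])
end

section
/- Let n ≥ 3 be a natural number, let F be any field, and let K be an infinite field extending F (via a ring homomorphism F → K). Index vectors by ℤ/nℤ and let s denote the cyclic shift (s w)_i = w_{i−1}. Let u, v ∈ Fⁿ with u_i = 0 and v_i = 0 for all i ≠ 0, 1, write u₀ = u₁-coordinates as u₁', u₂' and v-coordinates as v₁', v₂' (so u = (u₁', u₂', 0, …, 0), v = (v₁', v₂', 0, …, 0)), and assume u₁' + u₂' + v₁' + v₂' = 0. For x₀, …, x_{n−1} ∈ K define a(x₀,…,x_{n−1}) ∈ Mₙ(K) with (i,j)-entry x_j u_{i−j} + x_{j+1} v_{i−j} (indices mod n). If there is NO tuple (x₀,…,x_{n−1}) with all x_i ≠ 0 for which a(x₀,…,x_{n−1}) is invertible, then one of the following holds: (a) there exists ω ∈ F with ωⁿ = 1 such that u₁' + ω u₂'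 = 0 and v₁' + ω v₂' = 0; (b) u₁' + v₂' = 0 and u₂' = v₁' = 0; (c) u₁' = v₂' = 0 and u₂' + v₁' = 0. -/
/-- A property of residues mod `n` stable under adding one and true once is true everywhere. -/
theorem ZMod.forall_of_add_one {n : ℕ} [NeZero n] {p : ZMod n → Prop}
    (hp : ∀ i, p i → p (i + 1)) {j : ZMod n} (hj : p j) (i : ZMod n) : p i := by
  have h : ∀ k : ℕ, p (j + k) := by
    intro k
    induction k with
    | zero => simpa using hj
    | succ k ih => simpa [add_assoc] using hp _ ih
  have := h (i - j).val
  rwa [ZMod.natCast_zmod_val, add_sub_cancel] at this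

/-- If the cyclic bidiagonal system `y j * A j + y (j + 1) * B j = 0` has a nonzero solution,
then `∏ A j = ∏ (-B j)`. -/
theorem prod_eq_prod_neg_of_cyclic_system {n : ℕ} [NeZero n] {K : Type*} [Field K]
    {A B y : ZMod n → K} (hy : y ≠ 0) (h : ∀ j, y j * A j + y (j + 1) * B j = 0) :
    ∏ j, A j = ∏ j, -B j := by
  by_cases h0 : ∃ j, y j = 0
  · obtain ⟨j₀, hj₀⟩ := h0
    obtain ⟨j₁, hj₁⟩ := Function.ne_iff.mp hy
    have hB : ∃ j, y j = 0 ∧ y (j + 1) ≠ 0 := by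
      by_contra! hc
      exact hj₁ (ZMod.forall_of_add_one hc hj₀ j₁)
    have hA : ∃ j, y j ≠ 0 ∧ y (j + 1) = 0 := by
      by_contra! hc
      exact ZMod.forall_of_add_one (p := fun j => y j ≠ 0) hc hj₁ j₀ hj₀
    obtain ⟨j, hj, hj'⟩ := hA
    obtain ⟨k, hk, hk'⟩ := hB
    have hAj : A j = 0 := by simpa [hj, hj'] using h j
    have hBk : -B k = 0 := by simpa [hk, hk'] using h k
    rw [Finset.prod_eq_zero (Finset.mem_univ j) hAj, Finset.prod_eq_zero (Finset.mem_univ k) hBk]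
  · push Not at h0
    have hshift : ∏ j, y (j + 1) = ∏ j, y j :=
      Fintype.prod_equiv (Equiv.addRight 1) _ _ fun _ => rfl
    have hprod : (∏ j, y j) * ∏ j, A j = (∏ j, y j) * ∏ j, -B j := by
      nth_rewrite 2 [← hshift]
      rw [← Finset.prod_mul_distrib, ← Finset.prod_mul_distrib]
      exact Finset.prod_congr rfl fun j _ => by linear_combination h j
    exact mul_left_cancel₀ (Finset.prod_ne_zero_iff.mpr fun j _ => h0 j) hprod

/-- The linear form `x ↦ c * x j + d * x (j + 1)`. -/
def cyclicForm {n : ℕ} {K : Type*} [Field K] (c d : K) (j : ZMod n) :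
    Module.Dual K (ZMod n → K) :=
  c • LinearMap.proj j + d • LinearMap.proj (j + 1)

@[simp]
theorem cyclicForm_apply {n : ℕ} {K : Type*} [Field K] (c d : K) (j : ZMod n)
    (x : ZMod n → K) : cyclicForm c d j x = c * x j + d * x (j + 1) := by
  simp [cyclicForm]

theorem ZMod.one_ne_zero_of_three_le {n : ℕ} (hn : 3 ≤ n) : (1 : ZMod n) ≠ 0 := by
  have : Fact (1 < n) := ⟨by omega⟩
  exact one_ne_zero

theorem ZMod.one_add_one_ne_zero_of_three_le {n : ℕ} (hn : 3 ≤ n) : (1 + 1 : ZMod n) ≠ 0 := by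
  intro h
  have h2 : ((2 : ℕ) : ZMod n) = 0 := by
    push_cast
    rw [← h]
    norm_num
  have := Nat.le_of_dvd (by norm_num) ((ZMod.natCast_eq_zero_iff 2 n).mp h2)
  omega

/-- If `(a, b)` has nonzero entries and is not proportional to `(c, d)`, then some `x` with
nonzero coordinates is a zero of the first form of `(a, b)` and of no form of `(c, d)`. -/
theorem exists_cyclicForm_eq_zero_of_not_proportional {n : ℕ} [NeZero n] (hn : 3 ≤ n)
    {K : Type*} [Field K] [Infinite K] {a b c d : K} (ha : a ≠ 0) (hb : b ≠ 0)
    (hne : a * d ≠ b * c) :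
    ∃ x : ZMod n → K, (∀ i, x i ≠ 0) ∧ a * x 0 + b * x 1 = 0 ∧
      ∀ j, c * x j + d * x (j + 1) ≠ 0 := by
  have h1 := ZMod.one_ne_zero_of_three_le hn
  have h2 := ZMod.one_add_one_ne_zero_of_three_le hn
  let w : ZMod n → K := fun i => if i = 0 then b else if i = 1 then -a else 1
  have w0 : w 0 = b := by simp [w]
  have w1 : w 1 = -a := by simp [w, h1]
  have wne : ∀ i, w i ≠ 0 := by
    intro i
    simp only [w]
    split_ifs <;> simp [ha, hb]
  let p : Submodule K (ZMod n → K) := LinearMap.ker (cyclicForm a b 0)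
  have mem_p : ∀ x, x ∈ p ↔ a * x 0 + b * x 1 = 0 := by
    intro x
    simp [p]
  have hw : w ∈ p := by
    rw [mem_p, w0, w1]
    ring
  have hsingle : ∀ i : ZMod n, i ≠ 0 → i ≠ 1 → Pi.single i (1 : K) ∈ p := by
    intro i hi0 hi1
    rw [mem_p]
    simp [hi0.symm, hi1.symm]
  let f : ZMod n ⊕ ZMod n → Module.Dual K (ZMod n → K) :=
    Sum.elim (fun i => LinearMap.proj i) (cyclicForm c d)
  have hf : ∀ k, ∃ x ∈ p, f k x ≠ 0 := by
    rintro (i | j)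
    · exact ⟨w, hw, by simpa [f] using wne i⟩
    simp only [f, Sum.elim_inr, cyclicForm_apply]
    by_cases hj0 : j = 0
    · subst hj0
      refine ⟨w, hw, ?_⟩
      rw [zero_add, w0, w1]
      contrapose! hne
      linear_combination -hne
    by_cases hj1 : j = 1
    · subst hj1
      by_cases hd : d = 0
      · refine ⟨w, hw, ?_⟩
        have hc : c ≠ 0 := by
          rintro rfl
          simp [hd] at hne
        rw [hd, w1]
        simp [hc, ha]
      · refine ⟨_, hsingle (1 + 1) h2 (by simpa using h1), ?_⟩
        simp [h1, hd]
    by_cases hc : c = 0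
    · have hd : d ≠ 0 := by
        rintro rfl
        simp [hc] at hne
      refine ⟨w, hw, ?_⟩
      simp [hc, hd, wne]
    · refine ⟨_, hsingle j hj0 hj1, ?_⟩
      simp [h1, hc]
  obtain ⟨x, hxp, hx⟩ := Module.Dual.exists_forall_mem_ne_zero_of_forall_exists p f hf
  exact ⟨x, fun i => by simpa [f] using hx (.inl i), (mem_p x).mp hxp,
    fun j => by simpa [f] using hx (.inr j)⟩

/-- An equality of cyclic products of linear forms forces the forms to agree up to a factor
whose `n`-th power is one, provided one of them has both coefficients nonzero. -/
theorem proportional_of_prod_cyclicForm_eq {n : ℕ} [NeZero n] (hn : 3 ≤ n)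
    {K : Type*} [Field K] [Infinite K] {a b c d : K} (ha : a ≠ 0) (hb : b ≠ 0)
    (h : ∀ x : ZMod n → K, (∀ i, x i ≠ 0) →
      ∏ j, (a * x j + b * x (j + 1)) = ∏ j, (c * x j + d * x (j + 1))) :
    a * d = b * c ∧ c ^ n = a ^ n := by
  have hprop : a * d = b * c := by
    by_contra hne
    obtain ⟨x, hx, hx0, hxj⟩ := exists_cyclicForm_eq_zero_of_not_proportional hn ha hb hne
    refine Finset.prod_ne_zero_iff.mpr (fun j _ => hxj j) ((h x hx).symm.trans ?_)
    exact Finset.prod_eq_zero (Finset.mem_univ 0) (by simpa using hx0)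
  refine ⟨hprop, ?_⟩
  obtain ⟨t, ht⟩ := (Set.toFinite ({0, b / a} : Set K)).exists_notMem
  simp only [Set.mem_insert_iff, Set.mem_singleton_iff, not_or] at ht
  have hne : 1 * b ≠ t * a := by
    intro hta
    exact ht.2 (by rw [eq_div_iff ha, ← hta, one_mul])
  obtain ⟨x, hx, -, hxj⟩ :=
    exists_cyclicForm_eq_zero_of_not_proportional hn one_ne_zero ht.1 hne
  have hP : ∏ j, (a * x j + b * x (j + 1)) ≠ 0 := Finset.prod_ne_zero_iff.mpr fun j _ => hxj j
  refine mul_right_cancel₀ hP ?_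
  have hconst : ∀ e : K, e ^ n = ∏ _j : ZMod n, e := fun e => by simp [ZMod.card]
  nth_rewrite 2 [h x hx]
  rw [hconst, hconst, ← Finset.prod_mul_distrib, ← Finset.prod_mul_distrib]
  exact Finset.prod_congr rfl fun j _ => by linear_combination -x (j + 1) * hprop

/-- The version of `proportional_of_prod_cyclicForm_eq` over a subfield, giving the root of
unity in the subfield. -/
theorem exists_root_of_unity_of_prod_cyclicForm_eq {n : ℕ} [NeZero n] (hn : 3 ≤ n)
    {F K : Type*} [Field F] [Field K] [Infinite K] (φ : F →+* K) {a b c d : F}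
    (ha : a ≠ 0) (hb : b ≠ 0)
    (h : ∀ x : ZMod n → K, (∀ i, x i ≠ 0) →
      ∏ j, (φ a * x j + φ b * x (j + 1)) = ∏ j, (φ c * x j + φ d * x (j + 1))) :
    ∃ ω : F, ω ^ n = 1 ∧ c = ω * a ∧ d = ω * b := by
  obtain ⟨h1, h2⟩ := proportional_of_prod_cyclicForm_eq hn
    ((map_ne_zero φ).mpr ha) ((map_ne_zero φ).mpr hb) h
  simp only [← map_mul, ← map_pow] at h1 h2
  have h1' := φ.injective h1
  refine ⟨c / a, ?_, (div_mul_cancel₀ c ha).symm, ?_⟩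
  · rw [div_pow, φ.injective h2, div_self (pow_ne_zero n ha)]
  · field_simp
    linear_combination h1'

/-- Lemma 2.3: let `u = (u₁, u₂, 0, …, 0)` and `v = (v₁, v₂, 0, …, 0)` in `Fⁿ`
with `u₁ + u₂ + v₁ + v₂ = 0`. If the matrix `a(x₀,…,x_{n−1})` (with
`(i,j)`-entry `x_j u_{i−j} + x_{j+1} v_{i−j}`) is not invertible for any choice
of nonzero `xᵢ ∈ K`, then one of the three conclusions (a), (b), (c) holds. -/
theorem lemma_consequence
    (n : ℕ) [NeZero n] (hn : 3 ≤ n) (F : Type*) [Field F]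
    (K : Type*) [Field K] [Infinite K] (φ : F →+* K)
    (u1 u2 v1 v2 : F) (u v : ZMod n → F)
    (hu0 : u 0 = u1) (hu1 : u 1 = u2)
    (hu : ∀ i : ZMod n, i ≠ 0 → i ≠ 1 → u i = 0)
    (hv0 : v 0 = v1) (hv1 : v 1 = v2)
    (hv : ∀ i : ZMod n, i ≠ 0 → i ≠ 1 → v i = 0)
    (hsum : u1 + u2 + v1 + v2 = 0)
    (hS : ¬ ∃ x : ZMod n → K, (∀ i, x i ≠ 0) ∧
      IsUnit (Matrix.of fun i j : ZMod n =>
        x j * φ (u (i - j)) + x (j + 1) * φ (v (i - j)))) :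
    (∃ ω : F, ω ^ n = 1 ∧ u1 + ω * u2 = 0 ∧ v1 + ω * v2 = 0) ∨
    (u1 + v2 = 0 ∧ u2 = 0 ∧ v1 = 0) ∨
    (u1 = 0 ∧ v2 = 0 ∧ u2 + v1 = 0) := by
  have h1 := ZMod.one_ne_zero_of_three_le hn
  have hprod : ∀ x : ZMod n → K, (∀ i, x i ≠ 0) →
      ∏ j, (φ u1 * x j + φ v1 * x (j + 1)) = ∏ j, (φ (-u2) * x j + φ (-v2) * x (j + 1)) := by
    intro x hx
    have hM := not_exists.mp hS x
    rw [and_iff_right hx, Matrix.isUnit_iff_isUnit_det, isUnit_iff_ne_zero, not_ne_iff,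
      ← Matrix.exists_vecMul_eq_zero_iff] at hM
    obtain ⟨y, hy, hyM⟩ := hM
    have key := prod_eq_prod_neg_of_cyclic_system (A := fun j => φ u1 * x j + φ v1 * x (j + 1))
      (B := fun j => φ u2 * x j + φ v2 * x (j + 1)) hy ?_
    · refine key.trans (Finset.prod_congr rfl fun j _ => ?_)
      simp only [map_neg]
      ring
    · intro j
      have hj := congrFun hyM j
      simp only [Matrix.vecMul, dotProduct, Matrix.of_apply, Pi.zero_apply] at hj
      rw [Fintype.sum_eq_add j (j + 1) (by simpa using h1)] at hj
      · simp only [sub_self, add_sub_cancel_left, hu0, hu1, hv0, hv1] at hj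
        linear_combination hj
      · rintro i ⟨hij, hij'⟩
        have hi0 : i - j ≠ 0 := sub_ne_zero.mpr hij
        have hi1 : i - j ≠ 1 := fun h => hij' (by rw [← h, add_sub_cancel])
        simp [hu _ hi0 hi1, hv _ hi0 hi1]
  by_cases huv : u1 ≠ 0 ∧ v1 ≠ 0
  · obtain ⟨ω, hω, hc, hd⟩ := exists_root_of_unity_of_prod_cyclicForm_eq hn φ huv.1 huv.2 hprod
    have hω0 : ω ≠ 0 := by
      rintro rfl
      simp [NeZero.ne n] at hω
    refine Or.inl ⟨ω⁻¹, by rw [inv_pow, hω, inv_one], ?_, ?_⟩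
    · field_simp
      linear_combination -hc
    · field_simp
      linear_combination -hd
  by_cases huv' : -u2 ≠ 0 ∧ -v2 ≠ 0
  · obtain ⟨ω, hω, hc, hd⟩ := exists_root_of_unity_of_prod_cyclicForm_eq hn φ huv'.1 huv'.2
      fun x hx => (hprod x hx).symm
    exact Or.inl ⟨ω, hω, by linear_combination hc, by linear_combination hd⟩
  have hA : u1 = 0 ∨ v1 = 0 := by tauto
  have hB : u2 = 0 ∨ v2 = 0 := by
    simp only [ne_eq, neg_eq_zero] at huv'
    tauto
  rcases hA with rfl | rfl <;> rcases hB with rfl | rfl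
  · exact Or.inl ⟨1, one_pow n, by simp, by linear_combination hsum⟩
  · exact Or.inr (Or.inr ⟨rfl, rfl, by linear_combination hsum⟩)
  · exact Or.inr (Or.inl ⟨by linear_combination hsum, rfl, rfl⟩)
  · exact Or.inl ⟨1, one_pow n, by linear_combination hsum, by simp⟩
end

section
/- Let n ≥ 1 be a natural number and K an infinite field. Index vectors by ℤ/nℤ and let s denote the cyclic shift (s w)_i = w_{i−1}. Let u, v ∈ Kⁿ and assume that the n−1 vectors s u, s² u, …, s^{n−1} u are linearly independent. For x₀, …, x_{n−1} ∈ K let a(x₀,…,x_{n−1}) ∈ Mₙ(K) be the matrix with (i,j)-entry x_j u_{i−j} + x_{j+1} v_{i−j} (indices mod n). Then there exists a nonzero polynomial g ∈ K[X₀,…,X_{n−1}] such that for every tuple (x₀,…,x_{n−1}) with all x_i ≠ 0 and g(x₀,…,x_{n−1}) ≠ 0, the kernel of a(x₀,…,x_{n−1}) (as a linear map Kⁿ → Kⁿ) is either trivial or spanned by a single vector all of whose coordinates are nonzero. -/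
/-- A linearly independent family missing one index can be completed to an invertible matrix. -/
theorem exists_det_updateCol_ne_zero {ι K : Type*} [Fintype ι] [DecidableEq ι] [Field K]
    (A : Matrix ι ι K) (k : ι)
    (h : LinearIndependent K (fun j : {j : ι // j ≠ k} => A.col j.1)) :
    ∃ p : ι → K, (A.updateCol k p).det ≠ 0 := by
  have hlt : Submodule.span K (Set.range fun j : {j : ι // j ≠ k} => A.col j.1) < ⊤ := by
    refine Submodule.lt_top_of_finrank_lt_finrank ?_
    rw [finrank_span_eq_card h, Module.finrank_fintype_fun_eq_card]
    exact Fintype.card_subtype_lt (x := k) (by simp)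
  obtain ⟨p, -, hp⟩ := SetLike.exists_of_lt hlt
  refine ⟨p, ?_⟩
  have hli := linearIndependent_option'.2 ⟨h, hp⟩
  have hcols : LinearIndependent K (A.updateCol k p).col := by
    rw [← linearIndependent_equiv (Equiv.optionSubtypeNe k)]
    have hcomp : (A.updateCol k p).col ∘ Equiv.optionSubtypeNe k =
        fun o => o.casesOn' p fun j : {j : ι // j ≠ k} => A.col j.1 := by
      funext o
      ext i
      rcases o with _ | ⟨j, hj⟩
      · simp [Function.comp_apply, Matrix.col_apply]
      · simp [Function.comp_apply, Matrix.col_apply, Matrix.updateCol_ne hj]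
    rw [hcomp]
    exact hli
  exact ((Matrix.isUnit_iff_isUnit_det _).1
    (Matrix.linearIndependent_cols_iff_isUnit.1 hcols)).ne_zero

/-- Away from the wrap-around point, passing to the successor in `ZMod n` raises `val` by one. -/
theorem ZMod.val_add_one_of_ne_neg_one {n : ℕ} [NeZero n] {m : ZMod n} (hm : m ≠ -1) :
    (m + 1).val = m.val + 1 := by
  have hlt : m.val + 1 < n := by
    refine lt_of_le_of_ne (Nat.succ_le_of_lt m.val_lt) fun h => hm ?_
    have := congrArg (Nat.cast : ℕ → ZMod n) h
    push_cast at this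
    rw [ZMod.natCast_zmod_val, ZMod.natCast_self] at this
    exact eq_neg_of_add_eq_zero_left this
  have : ((m.val + 1 : ℕ) : ZMod n) = m + 1 := by
    push_cast
    rw [ZMod.natCast_zmod_val]
  rw [← this, ZMod.val_natCast, Nat.mod_eq_of_lt hlt]

/-- The matrix with `j`-th column `s^j (x_j u + x_{j+1} v)`, where `s` is the cyclic shift. -/
def shiftMatrix {n : ℕ} {R : Type*} [CommRing R] (u v x : ZMod n → R) : Matrix (ZMod n) (ZMod n) R :=
  Matrix.of fun i j => x j * u (i - j) + x (j + 1) * v (i - j)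

theorem RingHom.map_det_updateCol_shiftMatrix {n : ℕ} [NeZero n] {R S : Type*} [CommRing R]
    [CommRing S] (f : R →+* S) (u v x p : ZMod n → R) (k : ZMod n) :
    f ((shiftMatrix u v x).updateCol k p).det =
      ((shiftMatrix (f ∘ u) (f ∘ v) (f ∘ x)).updateCol k (f ∘ p)).det := by
  rw [RingHom.map_det]
  congr 1
  ext i j
  by_cases h : j = k
  · subst h
    simp
  · simp [shiftMatrix, Matrix.updateCol_ne h]

/-- If the columns of the shift matrix of `u` other than the `k`-th are completed by `p` to an
invertible matrix, then the same holds generically for `shiftMatrix u v x`. -/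
theorem det_updateCol_shiftMatrix_X_ne_zero {n : ℕ} [NeZero n] {K : Type*} [Field K]
    (u v p : ZMod n → K) (k : ZMod n)
    (hp : ((shiftMatrix u 0 1).updateCol k p).det ≠ 0) :
    ((shiftMatrix (MvPolynomial.C ∘ u) (MvPolynomial.C ∘ v)
      (MvPolynomial.X : ZMod n → MvPolynomial (ZMod n) K)).updateCol k
        (MvPolynomial.C ∘ p)).det ≠ 0 := by
  intro h0
  let e : ZMod n → ℕ := fun j => (j - k - 1).val + 1
  have he : ∀ j, j ≠ k → e (j + 1) = e j + 1 := by
    intro j hj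
    have : j - k - 1 ≠ -1 := fun h => hj (by linear_combination h)
    simp only [e]
    rw [← ZMod.val_add_one_of_ne_neg_one this]
    congr 2
    ring
  let t : Polynomial K := Polynomial.X
  let B : Matrix (ZMod n) (ZMod n) (Polynomial K) :=
    (Matrix.of fun i j => Polynomial.C (u (i - j)) + t * Polynomial.C (v (i - j))).updateCol k
      (Polynomial.C ∘ p)
  have h1 := congrArg
    (MvPolynomial.eval₂Hom (Polynomial.C : K →+* Polynomial K) fun j => t ^ e j) h0
  rw [RingHom.map_det_updateCol_shiftMatrix, map_zero] at h1
  have h2 : (Matrix.of fun i j => (if j = k then 1 else t ^ e j) * B i j).det = 0 := by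
    rw [← h1]
    congr 1
    ext1 i j
    by_cases h : j = k
    · subst h
      simp [B]
    · simp [B, shiftMatrix, h, he j h]
      ring
  rw [Matrix.det_mul_row, mul_eq_zero] at h2
  have hB : B.det = 0 := by
    refine h2.resolve_left (Finset.prod_ne_zero_iff.2 fun j _ => ?_)
    split_ifs
    · exact one_ne_zero
    · exact pow_ne_zero _ Polynomial.X_ne_zero
  apply hp
  have h3 := congrArg (Polynomial.evalRingHom (0 : K)) hB
  rw [RingHom.map_det, map_zero] at h3
  rw [← h3]
  congr 1
  ext i j
  by_cases h : j = k
  · subst h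
    simp [B]
  · simp [B, t, shiftMatrix, Matrix.updateCol_ne h]

/-- A matrix whose column `k` can be replaced so as to become invertible has no nonzero kernel
vector vanishing at `k`. -/
theorem Matrix.eq_zero_of_mulVec_eq_zero_of_apply_eq_zero {ι K : Type*} [Fintype ι]
    [DecidableEq ι] [Field K] {A : Matrix ι ι K} {k : ι} {p w : ι → K}
    (hA : (A.updateCol k p).det ≠ 0) (hw : A.mulVec w = 0) (hk : w k = 0) : w = 0 := by
  refine Matrix.eq_zero_of_mulVec_eq_zero hA ?_
  rw [← hw]
  ext i
  refine Finset.sum_congr rfl fun j _ => ?_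
  by_cases h : j = k
  · subst h
    simp [hk]
  · simp [Matrix.updateCol_ne h]

/-- Lemma 2.4: if `s u, s² u, …, s^{n−1} u` are linearly independent, then there
is a nonzero polynomial `g` such that whenever all `xᵢ` are nonzero and
`g(x₀,…,x_{n−1}) ≠ 0`, the kernel of `a(x₀,…,x_{n−1})` is either trivial or
spanned by a single vector with all entries nonzero. -/
theorem lemma_split_off
    (n : ℕ) [NeZero n] (hn : 1 ≤ n) (K : Type*) [Field K] [Infinite K]
    (u v : ZMod n → K)
    (hind : LinearIndependent K
      (fun j : {j : ZMod n // j ≠ 0} => (fun i : ZMod n => u (i - j.1)))) :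
    ∃ g : MvPolynomial (ZMod n) K, g ≠ 0 ∧
      ∀ x : ZMod n → K, (∀ i, x i ≠ 0) → MvPolynomial.eval x g ≠ 0 →
        ((∀ w : ZMod n → K,
            (Matrix.of fun i j : ZMod n =>
              x j * u (i - j) + x (j + 1) * v (i - j)).mulVec w = 0 → w = 0) ∨
          (∃ b : ZMod n → K, (∀ i, b i ≠ 0) ∧
            ∀ w : ZMod n → K,
              (Matrix.of fun i j : ZMod n =>
                x j * u (i - j) + x (j + 1) * v (i - j)).mulVec w = 0 ↔
              ∃ c : K, w = c • b)) := by
  have hex : ∀ k : ZMod n, ∃ p : ZMod n → K, ((shiftMatrix u 0 1).updateCol k p).det ≠ 0 := by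
    obtain ⟨p, hp⟩ := exists_det_updateCol_ne_zero (shiftMatrix u 0 1) 0 (by
      convert hind using 1
      ext j i
      simp [shiftMatrix, Matrix.col])
    intro k
    refine ⟨fun i => p (i - k), ?_⟩
    rw [← Matrix.det_submatrix_equiv_self (Equiv.subRight k)] at hp
    convert hp using 2
    ext i j
    by_cases h : j = k
    · subst h
      simp
    · simp [shiftMatrix, Matrix.updateCol_ne h, Matrix.updateCol_ne (sub_ne_zero.2 h)]
  choose p hp using hex
  refine ⟨∏ k, ((shiftMatrix (MvPolynomial.C ∘ u) (MvPolynomial.C ∘ v)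
      MvPolynomial.X).updateCol k (MvPolynomial.C ∘ p k)).det,
    Finset.prod_ne_zero_iff.2 fun k _ => det_updateCol_shiftMatrix_X_ne_zero u v (p k) k (hp k),
    fun x _ hg => ?_⟩
  change (∀ w, (shiftMatrix u v x).mulVec w = 0 → w = 0) ∨
    ∃ b : ZMod n → K, (∀ i, b i ≠ 0) ∧
      ∀ w, (shiftMatrix u v x).mulVec w = 0 ↔ ∃ c : K, w = c • b
  rw [map_prod, Finset.prod_ne_zero_iff] at hg
  have key : ∀ k w, (shiftMatrix u v x).mulVec w = 0 → w k = 0 → w = 0 := by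
    intro k w
    refine Matrix.eq_zero_of_mulVec_eq_zero_of_apply_eq_zero (p := p k) ?_
    have := hg k (Finset.mem_univ k)
    rw [RingHom.map_det_updateCol_shiftMatrix] at this
    simpa [Function.comp_def] using this
  by_cases hker : ∀ w, (shiftMatrix u v x).mulVec w = 0 → w = 0
  · exact Or.inl hker
  push Not at hker
  obtain ⟨b, hb, hb0⟩ := hker
  have hbi : ∀ i, b i ≠ 0 := fun i h => hb0 (key i b hb h)
  refine Or.inr ⟨b, hbi, fun w => ⟨fun hw => ⟨w 0 / b 0, ?_⟩, ?_⟩⟩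
  · refine sub_eq_zero.1 (key 0 _ ?_ ?_)
    · rw [Matrix.mulVec_sub, Matrix.mulVec_smul, hw, hb, smul_zero, sub_zero]
    · simp [div_mul_cancel₀ _ (hbi 0)]
  · rintro ⟨c, rfl⟩
    rw [Matrix.mulVec_smul, hb, smul_zero]
end

section
/- Let n ≥ 3 be a natural number, K an infinite field, and λ ∈ K with λ ≠ 1. Then there exist d₁, …, dₙ ∈ K with d₁ + ⋯ + dₙ = 0 such that d_j ≠ λ·d_i for all i, j ∈ {1, …, n}. -/
/-- For `n ≥ 3`, an infinite field `K`, and `λ ≠ 1`, there exist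
`d₁, …, dₙ ∈ K` summing to zero with `d_j ≠ λ d_i` for all `i, j`. -/
theorem exists_trace_zero_tuple
    (n : ℕ) (hn : 3 ≤ n) (K : Type*) [Field K] [Infinite K]
    (l : K) (hl : l ≠ 1) :
    ∃ d : Fin n → K, (∑ i, d i) = 0 ∧ ∀ i j : Fin n, d j ≠ l * d i := by
  let sumForm : Module.Dual K (Fin n → K) := ∑ i, LinearMap.proj i
  have mem_ker (d : Fin n → K) : d ∈ LinearMap.ker sumForm ↔ ∑ i, d i = 0 := by
    simp [sumForm]
  let diffForm : Fin n × Fin n → Module.Dual K (Fin n → K) := fun p ↦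
    LinearMap.proj p.2 - l • LinearMap.proj p.1
  obtain ⟨d, hd, hne⟩ : ∃ d ∈ LinearMap.ker sumForm, ∀ p, diffForm p d ≠ 0 := by
    apply Module.Dual.exists_forall_mem_ne_zero_of_forall_exists
    rintro ⟨i, j⟩
    obtain ⟨k, hk⟩ : ∃ k, k ∉ ({i, j} : Finset (Fin n)) := by
      by_contra! h
      have hcard := Finset.card_le_two (a := i) (b := j)
      rw [Finset.eq_univ_iff_forall.mpr h, Finset.card_univ, Fintype.card_fin] at hcard
      omega
    simp only [Finset.mem_insert, Finset.mem_singleton, not_or] at hk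
    refine ⟨Pi.single j 1 - Pi.single k 1, by simp [mem_ker], ?_⟩
    by_cases hij : i = j
    · subst hij
      simpa [diffForm, Ne.symm hk.1, sub_eq_zero] using hl.symm
    · simp [diffForm, hij, Ne.symm hk.1, Ne.symm hk.2]
  exact ⟨d, (mem_ker d).mp hd, fun i j h ↦ hne (i, j) (by simp [diffForm, h])⟩
end
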